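/- The Dirac operator D satisfies the first-order condition modulo compact operators: for all elements x, y ∈ A, the operator [J y J^{−1}, [D, x]] (where [D, x] denotes the bounded extension of D x − x D, which exists) is a compact operator on H. -/

import Mathlib

noncomputable section

open scoped ComplexConjugate ENNReal InnerProductSpace

/-- Validity predicate for basis indices: the pair `(L, M)` of integers encodes the pair of
half-integers `(l, m) = (L/2, M/2)` with `l ∈ {1/2, 3/2, …}` and `m ∈ {-l, …, l}`. -/
def IdxP (p : ℤ × ℤ) : Prop := 0 < p.1 ∧ Odd p.1 ∧ Odd p.2 ∧ |p.2| ≤ p.1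

instance (p : ℤ × ℤ) : Decidable (IdxP p) := Classical.dec _

/-- The index set of the orthonormal basis `|l,m⟩`; `(L, M)` encodes `l = L/2`, `m = M/2`. -/
abbrev Idx : Type := { p : ℤ × ℤ // IdxP p }

/-- The Hilbert space `H = H_h ⊕ H_h`, realized as `ℓ²` over two copies of the index set;
the Boolean `true` marks the `+` copy and `false` the `-` copy. -/
abbrev HH : Type := lp (fun _ : Idx × Bool => ℂ) 2

/-- The basis vector `|l,m⟩_±` of `H` (`s = true` for `+`, `s = false` for `-`). -/
def bas (p : Idx) (s : Bool) : HH := lp.single 2 (p, s) 1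

/-- The sign `ε` attached to a copy of `H_h` inside `H`. -/
def sgn (s : Bool) : ℝ := if s then 1 else -1

/-- The `q`-number `[x] = (q^x - q^{-x})/(q - q⁻¹)`. -/
def qn (q x : ℝ) : ℝ := (q ^ x - q ^ (-x)) / (q - q⁻¹)

/-- Coefficient of `|l, m+1⟩` in `π_ε(a)|l,m⟩`. -/
def aC1 (q ε l m : ℝ) : ℝ :=
  ε * (1 + q ^ 2) * (q ^ (m - 1/2) / (qn q (2*l) * qn q (2*l + 2))) *
    Real.sqrt (qn q (l + m + 1) * qn q (l - m))

/-- Coefficient of `|l+1, m+1⟩` in `π_ε(a)|l,m⟩`. -/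
def aC2 (q l m : ℝ) : ℝ :=
  q ^ (m - l - 1/2) / qn q (2*l + 2) * Real.sqrt (qn q (l + m + 1) * qn q (l + m + 2))

/-- Coefficient of `|l-1, m+1⟩` in `π_ε(a)|l,m⟩` (which enters with a minus sign). -/
def aC3 (q l m : ℝ) : ℝ :=
  q ^ (m + l + 1/2) / qn q (2*l) * Real.sqrt (qn q (l - m) * qn q (l - m - 1))

/-- Coefficient of `|l, m⟩` in `π_ε(b)|l,m⟩`. -/
def bC1 (q ε l m : ℝ) : ℝ :=
  ε * ((qn q (l - m + 1) * qn q (l + m) - q ^ 2 * (qn q (l - m) * qn q (l + m + 1))) /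
    (qn q (2*l) * qn q (2*l + 2)))

/-- Coefficient of `|l+1, m⟩` in `π_ε(b)|l,m⟩` (which enters with a minus sign). -/
def bC2 (q l m : ℝ) : ℝ :=
  q ^ (m + 1) / qn q (2*l + 2) * Real.sqrt (qn q (l - m + 1) * qn q (l + m + 1))

/-- Coefficient of `|l-1, m⟩` in `π_ε(b)|l,m⟩` (which enters with a minus sign). -/
def bC3 (q l m : ℝ) : ℝ :=
  q ^ (m + 1) / qn q (2*l) * Real.sqrt (qn q (l - m) * qn q (l + m))

/-- The basis vector `|l,m⟩_±` of `H` (with `L = 2l`, `M = 2m`), defined to be `0` when the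
index is out of the allowed range. -/
def ket2 (s : Bool) (L M : ℤ) : HH :=
  if h : IdxP (L, M) then lp.single 2 ((⟨(L, M), h⟩ : Idx), s) 1 else 0

/-- The value of `π(a) = π₊(a) ⊕ π₋(a)` on the basis vector `|l,m⟩_±` of `H`. -/
def aVal2 (q : ℝ) (s : Bool) (L M : ℤ) : HH :=
  ((aC1 q (sgn s) (L/2 : ℝ) (M/2 : ℝ) : ℝ) : ℂ) • ket2 s L (M + 2)
    + ((aC2 q (L/2 : ℝ) (M/2 : ℝ) : ℝ) : ℂ) • ket2 s (L + 2) (M + 2)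
    - ((aC3 q (L/2 : ℝ) (M/2 : ℝ) : ℝ) : ℂ) • ket2 s (L - 2) (M + 2)

/-- The value of `π(b) = π₊(b) ⊕ π₋(b)` on the basis vector `|l,m⟩_±` of `H`. -/
def bVal2 (q : ℝ) (s : Bool) (L M : ℤ) : HH :=
  ((bC1 q (sgn s) (L/2 : ℝ) (M/2 : ℝ) : ℝ) : ℂ) • ket2 s L M
    - ((bC2 q (L/2 : ℝ) (M/2 : ℝ) : ℝ) : ℂ) • ket2 s (L + 2) M
    - ((bC3 q (L/2 : ℝ) (M/2 : ℝ) : ℝ) : ℂ) • ket2 s (L - 2) M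

/-- The index map `(l, m) ↦ (l, -m)`. -/
def pFlip (p : Idx) : Idx :=
  ⟨(p.1.1, -p.1.2), p.2.1, p.2.2.1, p.2.2.2.1.neg, by simpa using p.2.2.2.2⟩

/-! ### Basis vectors in light-cone coordinates -/

/-- Validity of the coordinates `k = l + m`, `n = l - m`. -/
def ValidKN (k n : ℤ) : Prop := 0 ≤ k ∧ 0 ≤ n ∧ Odd (k + n)

/-- The basis vector `|l,m⟩_±` in the coordinates `k = l + m`, `n = l - m`, and `0` when the
coordinates are out of range. -/
def el (k n : ℤ) (s : Bool) : HH := ket2 s (k + n) (k - n)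

lemma idxP_iff_validKN (k n : ℤ) : IdxP (k + n, k - n) ↔ ValidKN k n := by
  unfold IdxP ValidKN
  simp only [abs_le]
  constructor
  · rintro ⟨h1, h2, h3, h4, h5⟩
    exact ⟨by lia, by lia, h2⟩
  · rintro ⟨h1, h2, h3⟩
    obtain ⟨j, hj⟩ := h3
    exact ⟨by lia, ⟨j, hj⟩, ⟨j - n, by lia⟩, by lia, by lia⟩

lemma el_of_not_valid {k n : ℤ} (h : ¬ ValidKN k n) (s : Bool) : el k n s = 0 := by
  rw [← idxP_iff_validKN] at h
  simp [el, ket2, h]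

lemma exists_bas_eq_el {k n : ℤ} (h : ValidKN k n) :
    ∃ p : Idx, p.1 = (k + n, k - n) ∧ ∀ s, el k n s = bas p s := by
  rw [← idxP_iff_validKN] at h
  exact ⟨⟨_, h⟩, rfl, fun s => by simp [el, ket2, h, bas]⟩

lemma exists_el_eq_bas (p : Idx) :
    ∃ k n : ℤ, ValidKN k n ∧ p.1 = (k + n, k - n) ∧ ∀ s, bas p s = el k n s := by
  obtain ⟨⟨L, M⟩, hp⟩ := p
  obtain ⟨i, hi⟩ := hp.2.1
  obtain ⟨j, hj⟩ := hp.2.2.1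
  simp only at hi hj
  have e1 : L = (i + j + 1) + (i - j) := by lia
  have e2 : M = (i + j + 1) - (i - j) := by lia
  generalize i + j + 1 = k at e1 e2
  generalize i - j = n at e1 e2
  subst e1 e2
  exact ⟨k, n, (idxP_iff_validKN k n).1 hp, rfl, fun s => by simp [el, ket2, hp, bas]⟩

lemma norm_bas (p : Idx) (s : Bool) : ‖bas p s‖ = 1 := by
  unfold bas
  rw [lp.norm_single (by norm_num)]
  simp

lemma norm_el_le (k n : ℤ) (s : Bool) : ‖el k n s‖ ≤ 1 := by
  by_cases h : ValidKN k n
  · obtain ⟨p, -, hp⟩ := exists_bas_eq_el h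
    rw [hp, norm_bas]
  · simp [el_of_not_valid h]

lemma inner_bas_left (p : Idx) (s : Bool) (v : HH) : ⟪bas p s, v⟫_ℂ = v (p, s) := by
  unfold bas
  rw [lp.inner_single_left]
  simp

lemma inner_el_el (k n k' n' : ℤ) (s s' : Bool) (h : ValidKN k n) (h' : ValidKN k' n') :
    ⟪el k n s, el k' n' s'⟫_ℂ = if k = k' ∧ n = n' ∧ s = s' then 1 else 0 := by
  obtain ⟨p, hp, hp'⟩ := exists_bas_eq_el h
  obtain ⟨p₂, hp₂, hp₂'⟩ := exists_bas_eq_el h'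
  rw [hp', hp₂', inner_bas_left]
  unfold bas
  rw [lp.single_apply]
  have : ((p, s) = (p₂, s')) ↔ (k = k' ∧ n = n' ∧ s = s') := by
    rw [Prod.mk.injEq, Subtype.ext_iff, hp, hp₂, Prod.mk.injEq]
    constructor
    · rintro ⟨⟨h1, h2⟩, h3⟩
      exact ⟨by lia, by lia, h3⟩
    · rintro ⟨rfl, rfl, rfl⟩
      simp
  by_cases hc : k = k' ∧ n = n' ∧ s = s'
  · rw [if_pos hc]
    simp [this.2 hc]
  · rw [if_neg hc]
    have h0 := fun h => hc (this.1 h)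
    rw [Pi.single_apply, if_neg h0]

lemma ext_inner_el {v w : HH}
    (h : ∀ k n s, ValidKN k n → ⟪el k n s, v⟫_ℂ = ⟪el k n s, w⟫_ℂ) : v = w := by
  ext ⟨p, s⟩
  obtain ⟨k, n, hv, -, hp⟩ := exists_el_eq_bas p
  rw [← inner_bas_left, ← inner_bas_left, hp]
  exact h k n s hv

lemma clm_ext_bas {X Y : HH →L[ℂ] HH} (h : ∀ p s, X (bas p s) = Y (bas p s)) : X = Y := by
  refine lp.ext_continuousLinearMap (by norm_num) fun i => ?_
  refine ContinuousLinearMap.ext_ring ?_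
  exact h i.1 i.2

lemma clm_ext_el {X Y : HH →L[ℂ] HH} (h : ∀ k n s, X (el k n s) = Y (el k n s)) : X = Y := by
  refine clm_ext_bas fun p s => ?_
  obtain ⟨k, n, -, -, hp⟩ := exists_el_eq_bas p
  rw [hp]
  exact h k n s

/-! ### A summability criterion for compactness -/

lemma isCompactOperator_of_summable_norm_bas {X : HH →L[ℂ] HH}
    (h : Summable fun i : Idx × Bool => ‖X (bas i.1 i.2)‖) : IsCompactOperator X := by
  let R : Idx × Bool → HH →L[ℂ] HH :=
    fun i => (innerSL ℂ (bas i.1 i.2)).smulRight (X (bas i.1 i.2))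
  have hR : ∀ i, IsCompactOperator (R i) := fun i => by
    have h0 : IsCompactOperator ((ContinuousLinearMap.id ℂ ℂ).smulRight (X (bas i.1 i.2))) :=
      isCompactOperator_of_locallyCompactSpace_rng _
    exact h0.comp_clm (innerSL ℂ (bas i.1 i.2))
  have hs : Summable R := by
    refine Summable.of_norm_bounded h fun i => ?_
    simp [R, ContinuousLinearMap.norm_smulRight_apply, norm_bas]
  have hX : ∑' i, R i = X := by
    refine clm_ext_bas fun p s => ?_
    have h1 := (ContinuousLinearMap.apply ℂ HH (bas p s)).map_tsum hs
    simp only [ContinuousLinearMap.apply_apply] at h1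
    rw [h1, tsum_eq_single (p, s)]
    · simp [R, norm_bas]
    · rintro ⟨p', s'⟩ hne
      have : ⟪bas p' s', bas p s⟫_ℂ = 0 := by
        rw [inner_bas_left, bas, lp.single_apply]
        simp [hne]
      simp [R, this]
  have hmem : X ∈ {f : HH →L[ℂ] HH | IsCompactOperator f} := by
    rw [← hX]
    refine isClosed_setOfPred_isCompactOperator.mem_of_tendsto hs.hasSum
      (Filter.Eventually.of_forall fun F => ?_)
    induction F using Finset.induction_on with
    | empty => exact isCompactOperator_zero
    | insert i F hi ih =>
      rw [Finset.sum_insert hi]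
      exact (hR i).add ih
  exact hmem

lemma summable_zpow_idx {r : ℝ} (h0 : 0 < r) (h1 : r < 1) :
    Summable fun i : Idx × Bool => r ^ i.1.1.1 := by
  have hg : Summable fun j : (ℕ × ℕ) × Bool => r ^ j.1.1 * r ^ j.1.2 := by
    have := (summable_geometric_of_lt_one h0.le h1).mul_of_nonneg
      (summable_geometric_of_lt_one h0.le h1) (fun _ => by positivity) (fun _ => by positivity)
    have h2 := this.mul_of_nonneg (Summable.of_finite (f := fun _ : Bool => (1 : ℝ)))
      (fun _ => by positivity) (fun _ => by positivity)
    simpa using h2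
  let σ : Idx × Bool → (ℕ × ℕ) × Bool :=
    fun i => ((((i.1.1.1 + i.1.1.2) / 2).toNat, ((i.1.1.1 - i.1.1.2) / 2).toNat), i.2)
  have key : ∀ k n : ℤ, (k + n + (k - n)) / 2 = k ∧ (k + n - (k - n)) / 2 = n := fun k n => by lia
  have hσ : Function.Injective σ := by
    rintro ⟨p, s⟩ ⟨p', s'⟩ h
    obtain ⟨k, n, hv, hp, -⟩ := exists_el_eq_bas p
    obtain ⟨k', n', hv', hp', -⟩ := exists_el_eq_bas p'
    simp only [σ, hp, hp', key, Prod.mk.injEq] at h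
    obtain ⟨⟨a, b⟩, c⟩ := h
    have ha : k = k' := by have := hv.1; have := hv'.1; lia
    have hb : n = n' := by have := hv.2.1; have := hv'.2.1; lia
    rw [Prod.mk.injEq, Subtype.ext_iff, hp, hp', ha, hb]
    exact ⟨rfl, c⟩
  refine (hg.comp_injective hσ).congr fun ⟨p, s⟩ => ?_
  obtain ⟨k, n, hv, hp, -⟩ := exists_el_eq_bas p
  simp only [Function.comp, σ, hp, key]
  rw [zpow_add₀ h0.ne', ← zpow_natCast, ← zpow_natCast, Int.toNat_of_nonneg hv.1,
    Int.toNat_of_nonneg hv.2.1]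

lemma isCompactOperator_of_norm_el_le {X : HH →L[ℂ] HH} {r C : ℝ} (h0 : 0 < r) (h1 : r < 1)
    (h : ∀ k n s, ValidKN k n → ‖X (el k n s)‖ ≤ C * r ^ (k + n)) : IsCompactOperator X := by
  refine isCompactOperator_of_summable_norm_bas
    (Summable.of_nonneg_of_le (fun _ => norm_nonneg _) ?_ ((summable_zpow_idx h0 h1).mul_left C))
  rintro ⟨p, s⟩
  obtain ⟨k, n, hv, hp, hb⟩ := exists_el_eq_bas p
  simpa only [hb, hp] using h k n s hv

/-! ### Weighted shift operators -/

/-- The coefficient `c` vanishes unless both the source and the target of the shift are valid. -/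
def Supported (dk dn : ℤ) (c : ℤ → ℤ → Bool → ℂ) : Prop :=
  ∀ k n s, c k n s ≠ 0 → ValidKN k n ∧ ValidKN (k + dk) (n + dn)

/-- `X` is a weighted shift: it moves the coordinates `(k, n)` by `(dk, dn)`, exchanges the two
copies of `H_h` when `t = true`, and multiplies by the coefficient `c`. -/
structure IsShift (X : HH →L[ℂ] HH) (dk dn : ℤ) (t : Bool) (c : ℤ → ℤ → Bool → ℂ) : Prop where
  supp : Supported dk dn c
  app : ∀ k n s, X (el k n s) = c k n s • el (k + dk) (n + dn) (xor s t)

lemma IsShift.of_valid {X : HH →L[ℂ] HH} {dk dn : ℤ} {t : Bool} {c : ℤ → ℤ → Bool → ℂ}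
    (supp : Supported dk dn c)
    (app : ∀ k n s, ValidKN k n → ValidKN (k + dk) (n + dn) →
      X (el k n s) = c k n s • el (k + dk) (n + dn) (xor s t))
    (app' : ∀ k n s, ValidKN k n → ¬ ValidKN (k + dk) (n + dn) → X (el k n s) = 0) :
    IsShift X dk dn t c := by
  refine ⟨supp, fun k n s => ?_⟩
  by_cases h1 : ValidKN k n
  · by_cases h2 : ValidKN (k + dk) (n + dn)
    · exact app k n s h1 h2
    · rw [app' k n s h1 h2, el_of_not_valid h2, smul_zero]
  · have : c k n s = 0 := by
      by_contra h
      exact h1 (supp k n s h).1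
    rw [el_of_not_valid h1, this, map_zero, zero_smul]

/-- The isometry of `ℓ²` spaces which permutes basis vectors along an injective map. -/
lemma exists_isometry_of_injective {β : Type} [DecidableEq β] (σ : Idx × Bool → β)
    (hσ : Function.Injective σ) :
    ∃ U : HH →ₗᵢ[ℂ] lp (fun _ : β => ℂ) 2, ∀ p s, U (bas p s) = lp.single 2 (σ (p, s)) 1 := by
  have ho : Orthonormal ℂ fun i : Idx × Bool => (lp.single 2 (σ i) 1 : lp (fun _ : β => ℂ) 2) := by
    rw [orthonormal_iff_ite]
    intro i j
    rw [lp.inner_single_left, lp.single_apply, Pi.single_apply]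
    simp [hσ.eq_iff]
  refine ⟨ho.orthogonalFamily.linearIsometry, fun p s => ?_⟩
  unfold bas
  rw [OrthogonalFamily.linearIsometry_apply_single]
  simp

lemma exists_isShift (dk dn : ℤ) (t : Bool) (c : ℤ → ℤ → Bool → ℂ)
    (supp : Supported dk dn c)
    {C : ℝ} (hC : ∀ k n s, ‖c k n s‖ ≤ C) : ∃ X, IsShift X dk dn t c := by
  have hC0 : 0 ≤ C := (norm_nonneg _).trans (hC 0 0 true)
  let ka : Idx → ℤ := fun p => (p.1.1 + p.1.2) / 2
  let na : Idx → ℤ := fun p => (p.1.1 - p.1.2) / 2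
  have hka : ∀ (p : Idx) (k n : ℤ), p.1 = (k + n, k - n) → ka p = k ∧ na p = n := by
    intro p k n h
    simp only [ka, na, h]
    lia
  have hinj : ∀ p p', ka p = ka p' → na p = na p' → p = p' := by
    intro p p' h1 h2
    obtain ⟨k, n, -, hp, -⟩ := exists_el_eq_bas p
    obtain ⟨k', n', -, hp', -⟩ := exists_el_eq_bas p'
    rw [(hka p k n hp).1, (hka p' k' n' hp').1] at h1
    rw [(hka p k n hp).2, (hka p' k' n' hp').2] at h2
    rw [Subtype.ext_iff, hp, hp', h1, h2]
  let σ : Idx × Bool → ℤ × ℤ × Bool := fun i => (ka i.1, na i.1, i.2)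
  let τ : Idx × Bool → ℤ × ℤ × Bool := fun i => (ka i.1 + dk, na i.1 + dn, xor i.2 t)
  obtain ⟨U, hU⟩ := exists_isometry_of_injective σ (by
    rintro ⟨p, s⟩ ⟨p', s'⟩ h
    simp only [σ, Prod.mk.injEq] at h
    rw [hinj p p' h.1 h.2.1, h.2.2])
  obtain ⟨W, hW⟩ := exists_isometry_of_injective τ (by
    rintro ⟨p, s⟩ ⟨p', s'⟩ h
    simp only [τ, Prod.mk.injEq, add_left_inj, Bool.xor_left_inj] at h
    rw [hinj p p' h.1 h.2.1, h.2.2])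
  let m : Idx × Bool → ℂ →L[ℂ] ℂ := fun i => c (ka i.1) (na i.1) i.2 • ContinuousLinearMap.id ℂ ℂ
  have hm : ∀ i, ‖m i‖ ≤ C := fun i => by
    simp only [m, norm_smul, ContinuousLinearMap.norm_id, mul_one]
    exact hC _ _ _
  let M : HH →L[ℂ] HH := lp.mapCLM 2 m hC0 hm
  have hM : ∀ p s, M (bas p s) = c (ka p) (na p) s • bas p s := by
    intro p s
    ext i
    have h1 : (M (bas p s)) i = c (ka i.1) (na i.1) i.2 * (bas p s) i := rfl
    rw [h1, lp.coeFn_smul, Pi.smul_apply, smul_eq_mul, bas, lp.single_apply]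
    by_cases h : i = (p, s)
    · rw [h]
    · rw [Pi.single_apply, if_neg h, mul_zero, mul_zero]
  refine ⟨(ContinuousLinearMap.adjoint U.toContinuousLinearMap).comp
    (W.toContinuousLinearMap.comp M), IsShift.of_valid supp (fun k n s h1 h2 => ?_)
      (fun k n s h1 h2 => ?_)⟩
  · obtain ⟨p, hp, hb⟩ := exists_bas_eq_el h1
    obtain ⟨p', hp', hb'⟩ := exists_bas_eq_el h2
    have e1 := hka p k n hp
    have e2 := hka p' _ _ hp'
    have hWU : W (bas p s) = U (bas p' (xor s t)) := by
      rw [hU, hW]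
      simp only [σ, τ, e1, e2]
    have hUU : (ContinuousLinearMap.adjoint U.toContinuousLinearMap) (U (bas p' (xor s t)))
        = bas p' (xor s t) := by
      have := U.adjoint_comp_self
      exact congrArg (fun T : HH →L[ℂ] HH => T (bas p' (xor s t))) this
    simp only [ContinuousLinearMap.comp_apply, hb, hb', hM, e1, map_smul,
      LinearIsometry.coe_toContinuousLinearMap, hWU, hUU]
  · obtain ⟨p, hp, hb⟩ := exists_bas_eq_el h1
    have e1 := hka p k n hp
    have : c k n s = 0 := by
      by_contra h
      exact h2 (supp k n s h).2
    simp [ContinuousLinearMap.comp_apply, hb, hM, e1, this]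

lemma IsShift.star {X : HH →L[ℂ] HH} {dk dn : ℤ} {t : Bool} {c : ℤ → ℤ → Bool → ℂ}
    (h : IsShift X dk dn t c) :
    IsShift (star X) (-dk) (-dn) t fun k n s => conj (c (k - dk) (n - dn) (xor s t)) := by
  refine ⟨fun k n s hc => ?_, fun k n s => ?_⟩
  · have := h.supp (k - dk) (n - dn) (xor s t) (fun h0 => hc (by simp [h0]))
    rw [sub_add_cancel, sub_add_cancel] at this
    exact ⟨this.2, this.1⟩
  · refine ext_inner_el fun k' n' s' hv' => ?_
    rw [ContinuousLinearMap.star_eq_adjoint, ContinuousLinearMap.adjoint_inner_right, h.app,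
      inner_smul_left, inner_smul_right, ← sub_eq_add_neg, ← sub_eq_add_neg]
    by_cases he : k' = k - dk ∧ n' = n - dn ∧ s' = xor s t
    · obtain ⟨rfl, rfl, rfl⟩ := he
      by_cases hc : c (k - dk) (n - dn) (xor s t) = 0
      · simp [hc]
      · have := h.supp _ _ _ hc
        rw [inner_el_el _ _ _ _ _ _ hv' hv']
        rw [sub_add_cancel, sub_add_cancel] at this ⊢
        rw [inner_el_el _ _ _ _ _ _ this.2 this.2]
        simp
    · have r1 : conj (c k' n' s') * ⟪el (k' + dk) (n' + dn) (xor s' t), el k n s⟫_ℂ = 0 := by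
        by_cases hc : c k' n' s' = 0
        · simp [hc]
        by_cases hv : ValidKN k n
        · rw [inner_el_el _ _ _ _ _ _ (h.supp _ _ _ hc).2 hv, if_neg, mul_zero]
          rintro ⟨rfl, rfl, rfl⟩
          exact he (by simp)
        · simp [el_of_not_valid hv]
      have r2 : ⟪el k' n' s', el (k - dk) (n - dn) (xor s t)⟫_ℂ = 0 := by
        by_cases hv : ValidKN (k - dk) (n - dn)
        · rw [inner_el_el _ _ _ _ _ _ hv' hv, if_neg he]
        · simp [el_of_not_valid hv]
      rw [r1, r2, mul_zero]

/-! ### Coefficients depending on one light-cone coordinate up to rapid decay -/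

/-- Up to an error `O(r^(2l))`, the coefficient `c` of the shift by `(dk, dn)` is a function `f` of
`k` alone, and `f` converges to a limit at rate `r^k`; the limit is zero if `n` is shifted. -/
def AlmostFun (r : ℝ) (dk dn : ℤ) (c : ℤ → ℤ → Bool → ℂ) : Prop :=
  ∃ (C : ℝ) (γ : ℂ) (f : ℤ → ℂ), 0 ≤ C ∧
    (∀ k n s, ValidKN k n → ValidKN (k + dk) (n + dn) → ‖c k n s - f k‖ ≤ C * r ^ (k + n)) ∧
    (∀ k, 0 ≤ k → 0 ≤ k + dk → ‖f k - γ‖ ≤ C * r ^ k) ∧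
    (dn ≠ 0 → γ = 0)

lemma AlmostFun.of_supported {r : ℝ} {dk dn : ℤ} {c : ℤ → ℤ → Bool → ℂ} (h0 : 0 < r) (h1 : r < 1)
    (hd : Even (dk + dn)) (hs : Supported dk dn c) (h : AlmostFun r dk dn c) :
    ∃ (C : ℝ) (γ : ℂ) (f : ℤ → ℂ), 0 ≤ C ∧
      (∀ k n s, ValidKN k n → ‖c k n s - f k‖ ≤ C * r ^ (k + n)) ∧
      (∀ k, 0 ≤ k → ‖f k - γ‖ ≤ C * r ^ k) ∧ (dn ≠ 0 → γ = 0) := by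
  obtain ⟨C, γ, f, hC, hc, hf, hγ⟩ := h
  have p1 : 0 < r ^ dk := zpow_pos h0 _
  have p2 : 0 < r ^ dn := zpow_pos h0 _
  refine ⟨C + C * r ^ dn + ‖γ‖ * r ^ dk, γ, fun k => if k + dk < 0 then 0 else f k, by positivity,
    fun k n s hv => ?_, fun k hk => ?_, hγ⟩
  · have p3 : 0 < r ^ (k + n) := zpow_pos h0 _
    dsimp only
    by_cases hv' : ValidKN (k + dk) (n + dn)
    · rw [if_neg (not_lt.2 hv'.1)]
      refine (hc k n s hv hv').trans ?_
      gcongr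
      nlinarith [mul_nonneg hC p2.le, mul_nonneg (norm_nonneg γ) p1.le]
    · have hc0 : c k n s = 0 := by
        by_contra hne
        exact hv' (hs k n s hne).2
      rw [hc0]
      split_ifs with hk
      · simp only [sub_zero, norm_zero]
        positivity
      · have hn : n + dn < 0 := by
          by_contra hn
          refine hv' ⟨by lia, by lia, ?_⟩
          have := hv.2.2.add_even hd
          convert this using 1
          ring
        have hdn : dn ≠ 0 := by
          have := hv.2.1
          lia
        have h3 := hf k hv.1 (by lia)
        rw [hγ hdn, sub_zero] at h3
        rw [zero_sub, norm_neg]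
        refine h3.trans ?_
        have h4 : r ^ k ≤ r ^ dn * r ^ (k + n) := by
          rw [← zpow_add₀ h0.ne']
          exact zpow_le_zpow_right_of_le_one₀ h0 h1.le (by lia)
        calc C * r ^ k ≤ C * (r ^ dn * r ^ (k + n)) := by gcongr
          _ ≤ (C + C * r ^ dn + ‖γ‖ * r ^ dk) * r ^ (k + n) := by
            rw [← mul_assoc]
            gcongr
            nlinarith [mul_nonneg (norm_nonneg γ) p1.le]
  · have p3 : 0 < r ^ k := zpow_pos h0 _
    dsimp only
    split_ifs with hk'
    · rw [zero_sub, norm_neg]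
      have h4 : 1 ≤ r ^ dk * r ^ k := by
        rw [← zpow_add₀ h0.ne']
        exact one_le_zpow_of_nonpos₀ h0 h1.le (by lia)
      have h5 : ‖γ‖ ≤ ‖γ‖ * (r ^ dk * r ^ k) := le_mul_of_one_le_right (norm_nonneg _) h4
      refine h5.trans ?_
      rw [← mul_assoc]
      gcongr
      nlinarith [mul_nonneg hC p2.le]
    · refine (hf k hk (by lia)).trans ?_
      gcongr
      nlinarith [mul_nonneg hC p2.le, mul_nonneg (norm_nonneg γ) p1.le]

lemma AlmostFun.bounds {r : ℝ} {dk dn : ℤ} {c : ℤ → ℤ → Bool → ℂ} (h0 : 0 < r) (h1 : r < 1)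
    (hd : Even (dk + dn)) (hs : Supported dk dn c) (h : AlmostFun r dk dn c) :
    ∃ C : ℝ, 0 ≤ C ∧ (∀ k n s, ‖c k n s‖ ≤ C) ∧
      (dn ≠ 0 → ∀ k n s, ValidKN k n → ‖c k n s‖ ≤ C * r ^ k) ∧
      (∀ k n s k' n' s', ValidKN k n → ValidKN k' n' →
        ‖c k' n' s' - c k n s‖ ≤ C * (r ^ k + r ^ k')) ∧
      (∀ k n s n' s', ValidKN k n → ValidKN k n' →
        ‖c k n' s' - c k n s‖ ≤ C * (r ^ (k + n) + r ^ (k + n'))) := by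
  obtain ⟨C, γ, f, hC, hc, hf, hγ⟩ := h.of_supported h0 h1 hd hs
  have hk1 : ∀ k : ℤ, 0 ≤ k → r ^ k ≤ 1 := fun k hk => zpow_le_one₀ h0 h1.le hk
  have hkn : ∀ k n : ℤ, 0 ≤ n → r ^ (k + n) ≤ r ^ k := fun k n hn =>
    zpow_le_zpow_right_of_le_one₀ h0 h1.le (by lia)
  have key : ∀ k n s, ValidKN k n → ‖c k n s - γ‖ ≤ 2 * C * r ^ k := fun k n s hv => by
    have e : c k n s - γ = (c k n s - f k) + (f k - γ) := by ring
    rw [e]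
    refine (norm_add_le _ _).trans ?_
    nlinarith [hc k n s hv, hf k hv.1, mul_le_mul_of_nonneg_left (hkn k n hv.2.1) hC]
  refine ⟨2 * C + ‖γ‖, by positivity, fun k n s => ?_, fun hdn k n s hv => ?_,
    fun k n s k' n' s' hv hv' => ?_, fun k n s n' s' hv hv' => ?_⟩
  · by_cases hz : c k n s = 0
    · rw [hz, norm_zero]
      positivity
    · have hv := (hs k n s hz).1
      have e : c k n s = (c k n s - γ) + γ := by ring
      rw [e]
      refine (norm_add_le _ _).trans ?_
      have := key k n s hv
      nlinarith [hk1 k hv.1]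
  · have := key k n s hv
    rw [hγ hdn, sub_zero] at this
    rw [hγ hdn, norm_zero, add_zero]
    exact this
  · have e : c k' n' s' - c k n s = (c k' n' s' - γ) - (c k n s - γ) := by ring
    rw [e]
    refine (norm_sub_le _ _).trans ?_
    have p1 : 0 < r ^ k := zpow_pos h0 _
    have p2 : 0 < r ^ k' := zpow_pos h0 _
    nlinarith [key k n s hv, key k' n' s' hv', mul_nonneg (norm_nonneg γ) (add_pos p1 p2).le]
  · have e : c k n' s' - c k n s = (c k n' s' - f k) - (c k n s - f k) := by ring
    rw [e]
    refine (norm_sub_le _ _).trans ?_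
    have p1 : 0 < r ^ (k + n) := zpow_pos h0 _
    have p2 : 0 < r ^ (k + n') := zpow_pos h0 _
    nlinarith [hc k n s hv, hc k n' s' hv', mul_nonneg (norm_nonneg γ) (add_pos p1 p2).le,
      mul_nonneg hC (add_pos p1 p2).le]

/-- The coefficient obtained by exchanging the roles of `k` and `n`. -/
def swapC (c : ℤ → ℤ → Bool → ℂ) : ℤ → ℤ → Bool → ℂ := fun k n s => c n k s

lemma ValidKN.swap {k n : ℤ} (h : ValidKN k n) : ValidKN n k :=
  ⟨h.2.1, h.1, by rw [add_comm]; exact h.2.2⟩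

/-- A coefficient depending almost only on `k` changes little under a shift whose coefficient
depends almost only on `n`. -/
lemma norm_mul_sub_le {r : ℝ} {dk dn dk' dn' : ℤ} {c c' : ℤ → ℤ → Bool → ℂ} (h0 : 0 < r)
    (h1 : r < 1) (hd : Even (dk + dn)) (hd' : Even (dk' + dn')) (hs : Supported dk dn c)
    (hs' : Supported dk' dn' c') (h : AlmostFun r dk dn c)
    (h' : AlmostFun r dn' dk' (swapC c')) :
    ∃ C : ℝ, ∀ k n s s₁ s₂, ValidKN k n →
      ‖c' k n s * (c (k + dk') (n + dn') s₁ - c k n s₂)‖ ≤ C * r ^ (k + n) := by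
  obtain ⟨C, hC, -, -, hb2, hb3⟩ := h.bounds h0 h1 hd hs
  obtain ⟨C', hC', hb', ha', -, -⟩ := h'.bounds h0 h1 (by rwa [add_comm])
    (fun k n s hne => ⟨(hs' n k s hne).1.swap, (hs' n k s hne).2.swap⟩)
  have p1 : 0 < r ^ dk' := zpow_pos h0 _
  have p2 : 0 < r ^ dn' := zpow_pos h0 _
  refine ⟨C' * C * (1 + r ^ dk') + C' * C * (1 + r ^ dn'), fun k n s s₁ s₂ hv => ?_⟩
  have p3 : 0 < r ^ k := zpow_pos h0 _
  have p4 : 0 < r ^ n := zpow_pos h0 _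
  by_cases hz : c' k n s = 0
  · rw [hz, zero_mul, norm_zero]
    positivity
  have hv' := (hs' k n s hz).2
  rw [norm_mul]
  by_cases hdk : dk' = 0
  · subst hdk
    rw [add_zero] at hv' ⊢
    have e1 := hb3 k n s₂ (n + dn') s₁ hv hv'
    have e2 : ‖c' k n s‖ ≤ C' := hb' n k s
    calc ‖c' k n s‖ * ‖c k (n + dn') s₁ - c k n s₂‖
        ≤ C' * (C * (r ^ (k + n) + r ^ (k + (n + dn')))) := by gcongr
      _ = (C' * C * (1 + r ^ dn')) * r ^ (k + n) := by
        rw [← add_assoc, zpow_add₀ h0.ne' (k + n) dn']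
        ring
      _ ≤ _ := by
        gcongr
        have : 0 ≤ C' * C * (1 + r ^ (0 : ℤ)) := by positivity
        linarith
  · have e1 := hb2 k n s₂ (k + dk') (n + dn') s₁ hv hv'
    have e2 : ‖c' k n s‖ ≤ C' * r ^ n := ha' hdk n k s hv.swap
    calc ‖c' k n s‖ * ‖c (k + dk') (n + dn') s₁ - c k n s₂‖
        ≤ (C' * r ^ n) * (C * (r ^ k + r ^ (k + dk'))) := by gcongr
      _ = (C' * C * (1 + r ^ dk')) * r ^ (k + n) := by
        rw [zpow_add₀ h0.ne' k n, zpow_add₀ h0.ne' k dk']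
        ring
      _ ≤ _ := by
        gcongr
        have : 0 ≤ C' * C * (1 + r ^ dn') := by positivity
        linarith

lemma isCompactOperator_commutator {r : ℝ} {dk dn dk' dn' : ℤ} {t t' : Bool}
    {c c' : ℤ → ℤ → Bool → ℂ} {X Y : HH →L[ℂ] HH} (h0 : 0 < r)
    (h1 : r < 1) (hd : Even (dk + dn)) (hd' : Even (dk' + dn')) (hX : IsShift X dk dn t c)
    (hY : IsShift Y dk' dn' t' c') (h : AlmostFun r dk dn c)
    (h' : AlmostFun r dn' dk' (swapC c')) : IsCompactOperator (Y * X - X * Y) := by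
  obtain ⟨C₁, hC₁⟩ := norm_mul_sub_le h0 h1 hd hd' hX.supp hY.supp h h'
  obtain ⟨C₂, hC₂⟩ := norm_mul_sub_le (c := swapC c') (c' := swapC c) h0 h1
    (by rwa [add_comm]) (dk' := dn) (dn' := dk) (by rwa [add_comm])
    (fun k n s hne => ⟨(hY.supp n k s hne).1.swap, (hY.supp n k s hne).2.swap⟩)
    (fun k n s hne => ⟨(hX.supp n k s hne).1.swap, (hX.supp n k s hne).2.swap⟩) h' h
  refine isCompactOperator_of_norm_el_le (C := C₂ + C₁) h0 h1 fun k n s hv => ?_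
  have e : (Y * X - X * Y) (el k n s) =
      (c k n s * (c' (k + dk) (n + dn) (xor s t) - c' k n s)
        - c' k n s * (c (k + dk') (n + dn') (xor s t') - c k n s)) •
        el (k + dk + dk') (n + dn + dn') (xor (xor s t) t') := by
    have e1 : k + dk' + dk = k + dk + dk' := by ring
    have e2 : n + dn' + dn = n + dn + dn' := by ring
    have e3 : xor (xor s t') t = xor (xor s t) t' := by
      rw [Bool.xor_assoc, Bool.xor_assoc, Bool.xor_comm t' t]
    simp only [sub_apply, mul_apply_eq_comp, hX.app, hY.app,
      map_smul, smul_smul, e1, e2, e3, ← sub_smul]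
    congr 1
    ring
  rw [e, norm_smul]
  refine (mul_le_of_le_one_right (norm_nonneg _) (norm_el_le _ _ _)).trans ?_
  refine (norm_sub_le _ _).trans ?_
  rw [add_mul]
  refine add_le_add ?_ (hC₁ k n s _ _ hv)
  have := hC₂ n k s (xor s t) s hv.swap
  rw [add_comm n k] at this
  exact this

lemma AlmostFun.star {r : ℝ} {dk dn : ℤ} {c : ℤ → ℤ → Bool → ℂ} (h0 : 0 < r) (t : Bool)
    (h : AlmostFun r dk dn c) :
    AlmostFun r (-dk) (-dn) fun k n s => conj (c (k - dk) (n - dn) (xor s t)) := by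
  obtain ⟨C, γ, f, hC, hc, hf, hγ⟩ := h
  have p1 : 0 < r ^ (-dk) := zpow_pos h0 _
  have p2 : 0 < r ^ (-dk + -dn) := zpow_pos h0 _
  refine ⟨C * r ^ (-dk + -dn) + C * r ^ (-dk), conj γ, fun k => conj (f (k - dk)), by positivity,
    fun k n s hv hv' => ?_, fun k hk hk' => ?_, fun hdn => ?_⟩
  · rw [← map_sub, RCLike.norm_conj]
    refine (hc (k - dk) (n - dn) _ hv' ?_).trans ?_
    · rwa [sub_add_cancel, sub_add_cancel]
    · have e : k - dk + (n - dn) = (-dk + -dn) + (k + n) := by ring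
      have p3 : 0 < r ^ (k + n) := zpow_pos h0 _
      rw [e, zpow_add₀ h0.ne' (-dk + -dn), ← mul_assoc]
      gcongr
      nlinarith [mul_nonneg hC p1.le]
  · rw [← map_sub, RCLike.norm_conj]
    refine (hf (k - dk) hk' (by lia)).trans ?_
    have p3 : 0 < r ^ k := zpow_pos h0 _
    rw [sub_eq_add_neg, add_comm k, zpow_add₀ h0.ne' (-dk), ← mul_assoc]
    gcongr
    nlinarith [mul_nonneg hC p2.le]
  · rw [hγ (by lia), map_zero]

lemma AlmostFun.of_le {r r' : ℝ} {dk dn : ℤ} {c : ℤ → ℤ → Bool → ℂ} (h0 : 0 < r) (hr : r ≤ r')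
    (h : AlmostFun r dk dn c) : AlmostFun r' dk dn c := by
  obtain ⟨C, γ, f, hC, hc, hf, hγ⟩ := h
  refine ⟨C, γ, f, hC, fun k n s hv hv' => (hc k n s hv hv').trans ?_,
    fun k hk hk' => (hf k hk hk').trans ?_, hγ⟩
  · exact mul_le_mul_of_nonneg_left
      (zpow_le_zpow_left₀ (add_nonneg hv.1 hv.2.1) h0.le hr) hC
  · exact mul_le_mul_of_nonneg_left (zpow_le_zpow_left₀ hk h0.le hr) hC

/-- The coefficient of the commutator of the Dirac operator with a weighted shift. -/
def diracC (dk dn : ℤ) (c : ℤ → ℤ → Bool → ℂ) : ℤ → ℤ → Bool → ℂ := fun k n s =>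
  (((k : ℂ) + n + dk + dn) / 2 + 1 / 2) * c k n s - (((k : ℂ) + n) / 2 + 1 / 2) * c k n (!s)

lemma exists_mul_pow_le {r : ℝ} (h0 : 0 < r) (h1 : r < 1) :
    ∃ B : ℝ, 0 ≤ B ∧ ∀ N : ℤ, 0 ≤ N → (N : ℝ) * r ^ N ≤ B := by
  have h := tendsto_self_mul_const_pow_of_lt_one h0.le h1
  obtain ⟨B, hB⟩ := h.bddAbove_range
  refine ⟨max B 0, le_max_right _ _, fun N hN => ?_⟩
  lift N to ℕ using hN
  refine le_trans ?_ (le_max_left _ _)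
  have := hB ⟨N, rfl⟩
  simpa using this

lemma AlmostFun.diracC {r : ℝ} {dk dn : ℤ} {c : ℤ → ℤ → Bool → ℂ} (h0 : 0 < r) (h1 : r < 1)
    (h : AlmostFun (r ^ 2) dk dn c) : AlmostFun r dk dn (diracC dk dn c) := by
  obtain ⟨C, γ, f, hC, hc, hf, hγ⟩ := h
  obtain ⟨B, hB0, hB⟩ := exists_mul_pow_le h0 h1
  have hsq : ∀ N : ℤ, 0 ≤ N → (r ^ 2) ^ N = r ^ N * r ^ N ∧ 0 < r ^ N ∧ r ^ N ≤ 1 := fun N hN =>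
    ⟨by rw [sq, mul_zpow], zpow_pos h0 _, zpow_le_one₀ h0 h1.le hN⟩
  set a : ℂ := ((dk : ℂ) + dn) / 2 with ha
  refine ⟨‖a‖ * C + C * B + C, a * γ, fun k => a * f k, by positivity,
    fun k n s hv hv' => ?_, fun k hk hk' => ?_, fun hdn => by rw [hγ hdn, mul_zero]⟩
  · obtain ⟨e1, e2, e3⟩ := hsq (k + n) (add_nonneg hv.1 hv.2.1)
    have hN := hB (k + n) (add_nonneg hv.1 hv.2.1)
    have b1 := hc k n s hv hv'
    have b2 := hc k n (!s) hv hv'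
    have hkn : (0 : ℝ) ≤ ((k + n : ℤ) : ℝ) := by exact_mod_cast add_nonneg hv.1 hv.2.1
    rw [e1] at b1 b2
    have e : _root_.diracC dk dn c k n s - a * f k = a * (c k n s - f k)
        + ((((k + n : ℤ) : ℝ) / 2 + 1 / 2 : ℝ) : ℂ) * (c k n s - f k)
        - ((((k + n : ℤ) : ℝ) / 2 + 1 / 2 : ℝ) : ℂ) * (c k n (!s) - f k) := by
      rw [ha, _root_.diracC]
      push_cast
      ring
    rw [e]
    have n1 : ‖((((k + n : ℤ) : ℝ) / 2 + 1 / 2 : ℝ) : ℂ)‖ = ((k + n : ℤ) : ℝ) / 2 + 1 / 2 := by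
      rw [Complex.norm_real, Real.norm_of_nonneg (by positivity)]
    refine (norm_sub_le _ _).trans ((add_le_add_left (norm_add_le _ _) _).trans ?_)
    rw [norm_mul, norm_mul, norm_mul, n1]
    generalize ((k + n : ℤ) : ℝ) = x at *
    generalize r ^ (k + n) = y at *
    have hyy : y * y ≤ y := by nlinarith
    calc ‖a‖ * ‖c k n s - f k‖ + (x / 2 + 1 / 2) * ‖c k n s - f k‖
          + (x / 2 + 1 / 2) * ‖c k n (!s) - f k‖
        ≤ ‖a‖ * (C * (y * y)) + (x / 2 + 1 / 2) * (C * (y * y))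
          + (x / 2 + 1 / 2) * (C * (y * y)) := by gcongr
      _ = ‖a‖ * C * (y * y) + C * (x * y) * y + C * (y * y) := by ring
      _ ≤ ‖a‖ * C * y + C * B * y + C * y := by gcongr
      _ = _ := by ring
  · obtain ⟨e1, e2, e3⟩ := hsq k hk
    have b1 := hf k hk hk'
    rw [e1] at b1
    rw [← mul_sub, norm_mul]
    generalize r ^ k = y at *
    have hyy : y * y ≤ y := by nlinarith
    calc ‖a‖ * ‖f k - γ‖ ≤ ‖a‖ * (C * (y * y)) := by gcongr
      _ ≤ ‖a‖ * (C * y) := by gcongr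
      _ = ‖a‖ * C * y := by ring
      _ ≤ _ := by
        gcongr
        nlinarith [mul_nonneg hC hB0]

lemma Supported.diracC {dk dn : ℤ} {c : ℤ → ℤ → Bool → ℂ} (h : Supported dk dn c) :
    Supported dk dn (diracC dk dn c) := by
  intro k n s hne
  by_cases h1 : c k n s = 0
  · by_cases h2 : c k n (!s) = 0
    · exact absurd (by rw [_root_.diracC, h1, h2, mul_zero, mul_zero, sub_zero]) hne
    · exact h _ _ _ h2
  · exact h _ _ _ h1

/-! ### Elementary operators, and conjugation by the real structure -/

/-- A weighted shift preserving each copy of `H_h`, whose coefficient depends almost only on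
`k`. -/
def IsElementary (r : ℝ) (X : HH →L[ℂ] HH) : Prop :=
  ∃ dk dn c, Even (dk + dn) ∧ IsShift X dk dn false c ∧ AlmostFun r dk dn c

/-- A weighted shift whose coefficient depends almost only on `n`. -/
def IsMirror (r : ℝ) (Y : HH →L[ℂ] HH) : Prop :=
  ∃ dk dn t c, Even (dk + dn) ∧ IsShift Y dk dn t c ∧ AlmostFun r dn dk (swapC c)

lemma IsElementary.star {r : ℝ} {X : HH →L[ℂ] HH} (h0 : 0 < r) (h : IsElementary r X) :
    IsElementary r (star X) := by
  obtain ⟨dk, dn, c, hd, hX, hc⟩ := h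
  refine ⟨-dk, -dn, _, ?_, hX.star, hc.star h0 false⟩
  have := hd.neg
  rwa [neg_add] at this

/-- The operator `J y J⁻¹`, where `J⁻¹ = -J`. -/
def conjJ (J : HH →SL[starRingEnd ℂ] HH) (y : HH →L[ℂ] HH) : HH →L[ℂ] HH :=
  J.comp (y.comp (-J))

lemma conjJ_apply (J : HH →SL[starRingEnd ℂ] HH) (y : HH →L[ℂ] HH) (v : HH) :
    conjJ J y v = J (y (-(J v))) := rfl

lemma J_el {J : HH →SL[starRingEnd ℂ] HH}
    (hJ : ∀ (p : Idx) (s : Bool), J (bas p s) = (Complex.I ^ p.1.2) • bas (pFlip p) (!s))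
    (k n : ℤ) (s : Bool) : J (el k n s) = Complex.I ^ (k - n) • el n k (!s) := by
  by_cases hv : ValidKN k n
  · obtain ⟨p, hp, hb⟩ := exists_bas_eq_el hv
    obtain ⟨p', hp', hb'⟩ := exists_bas_eq_el hv.swap
    have e : pFlip p = p' := by
      rw [Subtype.ext_iff, hp']
      simp only [pFlip, hp]
      rw [neg_sub, add_comm]
    rw [hb, hJ, hb', e, hp]
  · have hv' : ¬ ValidKN n k := fun h => hv h.swap
    rw [el_of_not_valid hv, el_of_not_valid hv', map_zero, smul_zero]

lemma J_neg_J {J : HH →SL[starRingEnd ℂ] HH}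
    (hJ : ∀ (p : Idx) (s : Bool), J (bas p s) = (Complex.I ^ p.1.2) • bas (pFlip p) (!s))
    (v : HH) : -J (J v) = v := by
  have h : -(J.comp J) = ContinuousLinearMap.id ℂ HH := by
    refine clm_ext_el fun k n s => ?_
    by_cases hv : ValidKN k n
    · have hodd : Odd (k - n) := by
        obtain ⟨j, hj⟩ := hv.2.2
        exact ⟨j - n, by lia⟩
      have hI : (starRingEnd ℂ) (Complex.I ^ (k - n)) * Complex.I ^ (n - k) = -1 := by
        rw [map_zpow₀, Complex.conj_I, hodd.neg_zpow, neg_mul, ← zpow_add₀ Complex.I_ne_zero]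
        have : k - n + (n - k) = 0 := by ring
        rw [this, zpow_zero]
      simp only [neg_apply, ContinuousLinearMap.comp_apply, J_el hJ,
        ContinuousLinearMap.map_smulₛₗ, smul_smul, hI, Bool.not_not]
      simp
    · simp [el_of_not_valid hv]
  exact congrArg (fun T : HH →L[ℂ] HH => T v) h

lemma IsElementary.conjJ {r : ℝ} {J : HH →SL[starRingEnd ℂ] HH} {X : HH →L[ℂ] HH}
    (hJ : ∀ (p : Idx) (s : Bool), J (bas p s) = (Complex.I ^ p.1.2) • bas (pFlip p) (!s))
    (h : IsElementary r X) : IsMirror r (conjJ J X) := by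
  obtain ⟨dk, dn, c, hd, hX, C, γ, f, hC, hc, hf, hγ⟩ := h
  have hsupp : Supported dn dk fun k n s => Complex.I ^ (dk - dn) * conj (c n k (!s)) := by
    intro k n s hne
    have := hX.supp n k (!s) fun h0 => hne (by simp [h0])
    exact ⟨this.1.swap, this.2.swap⟩
  refine ⟨dn, dk, false, _, by rwa [add_comm], ⟨hsupp, fun k n s => ?_⟩,
    C, Complex.I ^ (dk - dn) * conj γ, fun k => Complex.I ^ (dk - dn) * conj (f k), hC,
    fun k n s hv hv' => ?_, fun k hk hk' => ?_, fun hdn => ?_⟩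
  · by_cases hv : ValidKN k n
    · have hodd : Odd (k - n) := by
        obtain ⟨j, hj⟩ := hv.2.2
        exact ⟨j - n, by lia⟩
      have hI : conj (Complex.I ^ (k - n)) * Complex.I ^ (n + dk - (k + dn))
          = -Complex.I ^ (dk - dn) := by
        rw [map_zpow₀, Complex.conj_I, hodd.neg_zpow, neg_mul, ← zpow_add₀ Complex.I_ne_zero]
        have : k - n + (n + dk - (k + dn)) = dk - dn := by ring
        rw [this]
      rw [conjJ_apply, J_el hJ, ← smul_neg, map_smul, map_neg, hX.app,
        ContinuousLinearMap.map_smulₛₗ, map_neg, ContinuousLinearMap.map_smulₛₗ, J_el hJ]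
      simp only [Bool.bne_false, Bool.not_not, smul_smul, ← neg_smul]
      congr 1
      linear_combination (-conj (c n k (!s))) * hI
    · rw [el_of_not_valid hv, map_zero]
      by_cases hz : Complex.I ^ (dk - dn) * conj (c n k (!s)) = 0
      · rw [hz, zero_smul]
      · exact absurd (hsupp _ _ _ hz).1 hv
  · simp only [swapC]
    rw [← mul_sub, ← map_sub, norm_mul, norm_zpow, Complex.norm_I, one_zpow, one_mul,
      RCLike.norm_conj]
    exact hc k n _ hv hv'
  · dsimp only
    rw [← mul_sub, ← map_sub, norm_mul, norm_zpow, Complex.norm_I, one_zpow, one_mul,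
      RCLike.norm_conj]
    exact hf k hk hk'
  · rw [hγ hdn, map_zero, mul_zero]

lemma conjJ_add (J : HH →SL[starRingEnd ℂ] HH) (y y' : HH →L[ℂ] HH) :
    conjJ J (y + y') = conjJ J y + conjJ J y' := by
  ext1 v
  simp only [conjJ_apply, add_apply, map_add]

lemma conjJ_mul {J : HH →SL[starRingEnd ℂ] HH}
    (hJ : ∀ (p : Idx) (s : Bool), J (bas p s) = (Complex.I ^ p.1.2) • bas (pFlip p) (!s))
    (y y' : HH →L[ℂ] HH) : conjJ J (y * y') = conjJ J y * conjJ J y' := by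
  ext1 v
  simp only [conjJ_apply, mul_apply_eq_comp, J_neg_J hJ]

lemma conjJ_algebraMap {J : HH →SL[starRingEnd ℂ] HH}
    (hJ : ∀ (p : Idx) (s : Bool), J (bas p s) = (Complex.I ^ p.1.2) • bas (pFlip p) (!s))
    (z : ℂ) : conjJ J (algebraMap ℂ (HH →L[ℂ] HH) z) = algebraMap ℂ (HH →L[ℂ] HH) (conj z) := by
  ext1 v
  rw [conjJ_apply, Algebra.algebraMap_eq_smul_one, Algebra.algebraMap_eq_smul_one]
  simp only [smul_apply, one_apply_eq_self, ContinuousLinearMap.map_smulₛₗ]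
  rw [map_neg, J_neg_J hJ]

/-! ### Commutators with the Dirac operator -/

section Dirac

variable {D : HH →ₗ.[ℂ] HH}

lemma el_mem_domain
    (hdom : D.domain = Submodule.span ℂ (Set.range fun y : Idx × Bool => bas y.1 y.2))
    (k n : ℤ) (s : Bool) : el k n s ∈ D.domain := by
  by_cases hv : ValidKN k n
  · obtain ⟨p, -, hb⟩ := exists_bas_eq_el hv
    rw [hb, hdom]
    exact Submodule.subset_span ⟨(p, s), rfl⟩
  · rw [el_of_not_valid hv]
    exact D.domain.zero_mem

lemma dirac_el
    (hD : ∀ (p : Idx) (s : Bool) (h : bas p s ∈ D.domain),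
      D ⟨bas p s, h⟩ = (((p.1.1 : ℝ) / 2 + 1 / 2 : ℝ) : ℂ) • bas p (!s))
    (k n : ℤ) (s : Bool) (h : el k n s ∈ D.domain) :
    D ⟨el k n s, h⟩ = (((k : ℂ) + n) / 2 + 1 / 2) • el k n (!s) := by
  by_cases hv : ValidKN k n
  · obtain ⟨p, hp, hb⟩ := exists_bas_eq_el hv
    have e := hD p s (hb s ▸ h)
    simp only [hb]
    rw [e, hp]
    push_cast
    rfl
  · have h0 := el_of_not_valid hv
    have : (⟨el k n s, h⟩ : D.domain) = 0 := Subtype.ext (h0 s)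
    rw [this, LinearPMap.map_zero, h0, smul_zero]

/-- The bounded operator `X` preserves the domain of `D` and `[D, X]` extends to a bounded
operator, such that both `X` and `[D, X]` commute up to compact operators with all weighted shifts
whose coefficient depends almost only on `n`. -/
def DiffCommutes (r : ℝ) (D : HH →ₗ.[ℂ] HH) (X : HH →L[ℂ] HH) : Prop :=
  ∃ hX : ∀ v ∈ D.domain, X v ∈ D.domain, ∃ T : HH →L[ℂ] HH,
    (∀ (v : HH) (hv : v ∈ D.domain), T v = D ⟨X v, hX v hv⟩ - X (D ⟨v, hv⟩)) ∧
    ∀ Y, IsMirror r Y → IsCompactOperator (Y * T - T * Y) ∧ IsCompactOperator (Y * X - X * Y)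

lemma DiffCommutes.add {r : ℝ} {X X' : HH →L[ℂ] HH} (h : DiffCommutes r D X)
    (h' : DiffCommutes r D X') : DiffCommutes r D (X + X') := by
  obtain ⟨hX, T, hT, hY⟩ := h
  obtain ⟨hX', T', hT', hY'⟩ := h'
  refine ⟨fun v hv => D.domain.add_mem (hX v hv) (hX' v hv), T + T', fun v hv => ?_,
    fun Y hm => ⟨?_, ?_⟩⟩
  · have e : (⟨(X + X') v, D.domain.add_mem (hX v hv) (hX' v hv)⟩ : D.domain)
        = ⟨X v, hX v hv⟩ + ⟨X' v, hX' v hv⟩ := rfl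
    rw [e, LinearPMap.map_add, add_apply, add_apply, hT v hv, hT' v hv]
    abel
  · have := (hY Y hm).1.add (hY' Y hm).1
    have e : Y * (T + T') - (T + T') * Y = (Y * T - T * Y) + (Y * T' - T' * Y) := by noncomm_ring
    rw [e]
    exact this
  · have := (hY Y hm).2.add (hY' Y hm).2
    have e : Y * (X + X') - (X + X') * Y = (Y * X - X * Y) + (Y * X' - X' * Y) := by noncomm_ring
    rw [e]
    exact this

/-- The commutator with a product is compact if the commutators with the factors are. -/
lemma isCompactOperator_commutator_mul {Y X X' : HH →L[ℂ] HH}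
    (h : IsCompactOperator (Y * X - X * Y)) (h' : IsCompactOperator (Y * X' - X' * Y)) :
    IsCompactOperator (Y * (X * X') - X * X' * Y) := by
  have e : Y * (X * X') - X * X' * Y = (Y * X - X * Y) * X' + X * (Y * X' - X' * Y) := by
    noncomm_ring
  rw [e]
  exact (h.comp_clm X').add (h'.clm_comp X)

lemma DiffCommutes.mul {r : ℝ} {X X' : HH →L[ℂ] HH} (h : DiffCommutes r D X)
    (h' : DiffCommutes r D X') : DiffCommutes r D (X * X') := by
  obtain ⟨hX, T, hT, hY⟩ := h
  obtain ⟨hX', T', hT', hY'⟩ := h'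
  refine ⟨fun v hv => hX _ (hX' v hv), T * X' + X * T', fun v hv => ?_, fun Y hm => ⟨?_, ?_⟩⟩
  · rw [add_apply, mul_apply_eq_comp, mul_apply_eq_comp, hT _ (hX' v hv), hT' v hv, map_sub]
    simp only [mul_apply_eq_comp]
    abel
  · have := (isCompactOperator_commutator_mul (hY Y hm).1 (hY' Y hm).2).add
      (isCompactOperator_commutator_mul (hY Y hm).2 (hY' Y hm).1)
    have e : Y * (T * X' + X * T') - (T * X' + X * T') * Y
        = (Y * (T * X') - T * X' * Y) + (Y * (X * T') - X * T' * Y) := by noncomm_ring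
    rw [e]
    exact this
  · exact isCompactOperator_commutator_mul (hY Y hm).2 (hY' Y hm).2

lemma DiffCommutes.algebraMap (r : ℝ) (z : ℂ) :
    DiffCommutes r D (algebraMap ℂ (HH →L[ℂ] HH) z) := by
  rw [Algebra.algebraMap_eq_smul_one]
  refine ⟨fun v hv => D.domain.smul_mem z hv, 0, fun v hv => ?_, fun Y _ => ⟨?_, ?_⟩⟩
  · have e : (⟨(z • (1 : HH →L[ℂ] HH)) v, D.domain.smul_mem z hv⟩ : D.domain) = z • ⟨v, hv⟩ := rfl
    rw [e, LinearPMap.map_smul]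
    simp
  · have e : Y * 0 - 0 * Y = 0 := by simp
    rw [e]
    exact isCompactOperator_zero
  · have e : Y * (z • 1) - (z • 1) * Y = 0 := by simp
    rw [e]
    exact isCompactOperator_zero

lemma IsElementary.diffCommutes {r : ℝ} {X : HH →L[ℂ] HH} (h0 : 0 < r) (h1 : r < 1)
    (hdom : D.domain = Submodule.span ℂ (Set.range fun y : Idx × Bool => bas y.1 y.2))
    (hD : ∀ (p : Idx) (s : Bool) (h : bas p s ∈ D.domain),
      D ⟨bas p s, h⟩ = (((p.1.1 : ℝ) / 2 + 1 / 2 : ℝ) : ℂ) • bas p (!s))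
    (h : IsElementary (r ^ 2) X) : DiffCommutes r D X := by
  obtain ⟨dk, dn, c, hd, hX, hc⟩ := h
  have hc' := hc.diracC h0 h1
  obtain ⟨C, -, hC, -⟩ := hc'.bounds h0 h1 hd hX.supp.diracC
  obtain ⟨T, hT⟩ := exists_isShift dk dn true _ hX.supp.diracC hC
  have hr : r ^ 2 ≤ r := by nlinarith
  have key : ∀ v ∈ D.domain, ∃ (hv : v ∈ D.domain) (hv' : X v ∈ D.domain),
      T v = D ⟨X v, hv'⟩ - X (D ⟨v, hv⟩) := by
    intro v hv
    rw [hdom] at hv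
    induction hv using Submodule.span_induction with
    | mem v hv =>
      obtain ⟨⟨p, s⟩, rfl⟩ := hv
      obtain ⟨k, n, -, -, hb⟩ := exists_el_eq_bas p
      simp only [hb]
      have e : X (el k n s) = c k n s • el (k + dk) (n + dn) s := by simpa using hX.app k n s
      have hm := el_mem_domain hdom (k + dk) (n + dn) s
      have hm' : X (el k n s) ∈ D.domain := e ▸ D.domain.smul_mem _ hm
      refine ⟨el_mem_domain hdom k n s, hm', ?_⟩
      have e' : (⟨X (el k n s), hm'⟩ : D.domain) = c k n s • ⟨_, hm⟩ := Subtype.ext e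
      rw [e', LinearPMap.map_smul, dirac_el hD, dirac_el hD, map_smul, hX.app, hT.app, smul_smul, smul_smul,
        Bool.xor_false, Bool.xor_true, ← sub_smul]
      congr 1
      rw [diracC]
      push_cast
      ring
    | zero =>
      refine ⟨D.domain.zero_mem, (map_zero X).symm ▸ D.domain.zero_mem, ?_⟩
      have e : (⟨X 0, (map_zero X).symm ▸ D.domain.zero_mem⟩ : D.domain) = 0 :=
        Subtype.ext (map_zero X)
      have e' : (⟨0, D.domain.zero_mem⟩ : D.domain) = 0 := rfl
      rw [e, e']
      simp
    | add v w _ _ hv hw =>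
      obtain ⟨a, a', ha⟩ := hv
      obtain ⟨b, b', hb⟩ := hw
      refine ⟨D.domain.add_mem a b, (map_add X v w).symm ▸ D.domain.add_mem a' b', ?_⟩
      have e : (⟨X (v + w), (map_add X v w).symm ▸ D.domain.add_mem a' b'⟩ : D.domain)
        = ⟨X v, a'⟩ + ⟨X w, b'⟩ := Subtype.ext (map_add X v w)
      have e' : (⟨v + w, D.domain.add_mem a b⟩ : D.domain) = ⟨v, a⟩ + ⟨w, b⟩ := rfl
      rw [e, e', LinearPMap.map_add, LinearPMap.map_add, map_add, map_add, ha, hb]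
      abel
    | smul z v _ hv =>
      obtain ⟨a, a', ha⟩ := hv
      refine ⟨D.domain.smul_mem z a, (map_smul X z v).symm ▸ D.domain.smul_mem z a', ?_⟩
      have e : (⟨X (z • v), (map_smul X z v).symm ▸ D.domain.smul_mem z a'⟩ : D.domain)
        = z • ⟨X v, a'⟩ := Subtype.ext (map_smul X z v)
      have e' : (⟨z • v, D.domain.smul_mem z a⟩ : D.domain) = z • ⟨v, a⟩ := rfl
      rw [e, e', LinearPMap.map_smul, LinearPMap.map_smul, map_smul, map_smul, ha, smul_sub]
  refine ⟨fun v hv => (key v hv).choose_spec.choose, T, fun v hv =>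
    (key v hv).choose_spec.choose_spec, fun Y hm => ?_⟩
  obtain ⟨dk', dn', t, c', hd', hY, hcY⟩ := hm
  exact ⟨isCompactOperator_commutator h0 h1 hd hd' hT hY hc' hcY,
    isCompactOperator_commutator h0 h1 hd hd' hX hY (hc.of_le (by positivity) hr) hcY⟩

end Dirac

/-! ### Asymptotics of the coefficients of the generators -/

section Estimates

variable {q : ℝ}

lemma inv_sub_self_pos (h0 : 0 < q) (h1 : q < 1) : 0 < q⁻¹ - q :=
  sub_pos.2 (h1.trans ((one_lt_inv₀ h0).2 h1))

lemma qn_eq (h0 : 0 < q) (x : ℝ) : qn q x = q ^ (-x) * (1 - q ^ (2 * x)) / (q⁻¹ - q) := by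
  have e : q ^ (-x) * q ^ (2 * x) = q ^ x := by
    rw [← Real.rpow_add h0]
    congr 1
    ring
  rw [qn, mul_sub, mul_one, e, ← neg_sub (q ^ (-x)), ← neg_sub q⁻¹ q, neg_div_neg_eq]

lemma sqrt_qn_mul_qn (h0 : 0 < q) (h1 : q < 1) (x y : ℝ) :
    √(qn q x * qn q y) =
      q ^ (-((x + y) / 2)) / (q⁻¹ - q) * √((1 - q ^ (2 * x)) * (1 - q ^ (2 * y))) := by
  have hδ := inv_sub_self_pos h0 h1
  have e : q ^ (-x) * q ^ (-y) = q ^ (-((x + y) / 2)) * q ^ (-((x + y) / 2)) := by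
    rw [← Real.rpow_add h0, ← Real.rpow_add h0]
    congr 1
    ring
  have e' : qn q x * qn q y = (q ^ (-((x + y) / 2)) / (q⁻¹ - q)) ^ 2 *
      ((1 - q ^ (2 * x)) * (1 - q ^ (2 * y))) := by
    rw [qn_eq h0, qn_eq h0, div_pow, sq (q ^ (-((x + y) / 2))), ← e]
    field_simp
  have hp : 0 ≤ q ^ (-((x + y) / 2)) / (q⁻¹ - q) := by positivity
  rw [e', Real.sqrt_mul (sq_nonneg _), Real.sqrt_sq hp]

lemma rpow_div_qn_mul_sqrt (h0 : 0 < q) (h1 : q < 1) (e w x y : ℝ) :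
    q ^ e / qn q w * √(qn q x * qn q y) = q ^ (e + w - (x + y) / 2) *
      (√((1 - q ^ (2 * x)) * (1 - q ^ (2 * y))) / (1 - q ^ (2 * w))) := by
  have hδ := inv_sub_self_pos h0 h1
  rw [sqrt_qn_mul_qn h0 h1, qn_eq h0, sub_eq_add_neg (e + w), Real.rpow_add h0, Real.rpow_add h0,
    Real.rpow_neg h0.le w]
  have hw : 0 < q ^ w := Real.rpow_pos_of_pos h0 _
  by_cases hz : 1 - q ^ (2 * w) = 0
  · simp [hz]
  · generalize q⁻¹ - q = δ at *
    field_simp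

lemma abs_div_one_sub_sub_le {S b w : ℝ} (hS : 0 ≤ S) (hS' : S ≤ 1) (hw : 0 ≤ w) (hb : 0 < b)
    (hwb : w ≤ 1 - b) : |S / (1 - w) - S| ≤ w / b := by
  have h : 0 < 1 - w := by linarith
  have e : S / (1 - w) - S = S * w / (1 - w) := by
    field_simp
    ring
  rw [e, abs_of_nonneg (by positivity)]
  exact div_le_div₀ hw (mul_le_of_le_one_left hw hS') hb (by linarith)

lemma sqrt_mul_le_one {u v : ℝ} (hu : 0 ≤ u) (hv : 0 ≤ v) (hv' : v ≤ 1) :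
    √((1 - u) * (1 - v)) ≤ 1 :=
  Real.sqrt_le_one.2 (by nlinarith)

lemma abs_sqrt_mul_sub_sqrt_le {u v : ℝ} (hu : 0 ≤ u) (hu' : u ≤ 1) (hv : 0 ≤ v) :
    |√((1 - u) * (1 - v)) - √(1 - v)| ≤ u := by
  have h1 : √(1 - v) ≤ 1 := Real.sqrt_le_one.2 (by linarith)
  have h2 : 1 - u ≤ √(1 - u) := Real.le_sqrt_of_sq_le (by nlinarith)
  have h3 : √(1 - u) ≤ 1 := Real.sqrt_le_one.2 (by linarith)
  rw [Real.sqrt_mul (by linarith), abs_le]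
  constructor <;> nlinarith [Real.sqrt_nonneg (1 - v)]

lemma abs_sqrt_sub_one_le {v : ℝ} (hv : 0 ≤ v) (hv' : v ≤ 1) : |√(1 - v) - 1| ≤ v := by
  simpa using abs_sqrt_mul_sub_sqrt_le (v := 0) hv hv' le_rfl

lemma rpow_le_rpow_of_ge (h0 : 0 < q) (h1 : q < 1) {x y : ℝ} (h : y ≤ x) : q ^ x ≤ q ^ y :=
  Real.rpow_le_rpow_of_exponent_ge h0 h1.le h

lemma rpow_le_sq (h0 : 0 < q) (h1 : q < 1) {x : ℝ} (h : 2 ≤ x) : q ^ x ≤ q ^ 2 := by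
  rw [← Real.rpow_two]
  exact rpow_le_rpow_of_ge h0 h1 h

lemma one_sub_sq_pos (h0 : 0 < q) (h1 : q < 1) : 0 < 1 - q ^ 2 := by nlinarith

lemma qn_nonneg (h0 : 0 < q) (h1 : q < 1) {x : ℝ} (hx : 0 ≤ x) : 0 ≤ qn q x := by
  have hδ := inv_sub_self_pos h0 h1
  have h := Real.rpow_le_one h0.le h1.le (by positivity : 0 ≤ 2 * x)
  rw [qn_eq h0]
  have := sub_nonneg.2 h
  positivity

lemma qn_le (h0 : 0 < q) (h1 : q < 1) (x : ℝ) : qn q x ≤ q ^ (-x) / (q⁻¹ - q) := by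
  have hδ := inv_sub_self_pos h0 h1
  rw [qn_eq h0]
  have h2 : 0 < q ^ (2 * x) := by positivity
  gcongr
  exact mul_le_of_le_one_right (by positivity) (by linarith)

lemma inv_qn_nonneg_and_le (h0 : 0 < q) (h1 : q < 1) {x : ℝ} (hx : 1 ≤ x) :
    0 ≤ (qn q x)⁻¹ ∧ (qn q x)⁻¹ ≤ (q⁻¹ - q) / (1 - q ^ 2) * q ^ x := by
  have hδ := inv_sub_self_pos h0 h1
  have hb := one_sub_sq_pos h0 h1
  have hw : q ^ (2 * x) ≤ q ^ 2 := rpow_le_sq h0 h1 (by linarith)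
  refine ⟨inv_nonneg.2 (qn_nonneg h0 h1 (by linarith)), ?_⟩
  have hq : 0 < q ^ x := Real.rpow_pos_of_pos h0 _
  have hb' : 0 < 1 - q ^ (2 * x) := by linarith
  have e : (qn q x)⁻¹ = (q⁻¹ - q) / (1 - q ^ (2 * x)) * q ^ x := by
    rw [qn_eq h0, Real.rpow_neg h0.le]
    field_simp
  rw [e]
  gcongr

lemma abs_aC1_le (h0 : 0 < q) (h1 : q < 1) {k n ε : ℝ} (hε : |ε| = 1) (hk : 0 ≤ k) (hn : 0 ≤ n)
    (hN : 1 ≤ k + n) : |aC1 q ε ((k + n) / 2) ((k - n) / 2)| ≤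
      (1 + q ^ 2) * (q⁻¹ - q) / (1 - q ^ 2) ^ 2 * q ^ (k + n) := by
  have hδ := inv_sub_self_pos h0 h1
  have hb := one_sub_sq_pos h0 h1
  obtain ⟨i1, i2⟩ := inv_qn_nonneg_and_le h0 h1 hN
  obtain ⟨j1, j2⟩ := inv_qn_nonneg_and_le h0 h1 (by linarith : 1 ≤ k + n + 2)
  have hS : √((1 - q ^ (2 * (k + 1))) * (1 - q ^ (2 * n))) ≤ 1 :=
    sqrt_mul_le_one (by positivity) (by positivity)
      (Real.rpow_le_one h0.le h1.le (by positivity))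
  have e1 : (k + n) / 2 + (k - n) / 2 + 1 = k + 1 := by ring
  have e2 : (k + n) / 2 - (k - n) / 2 = n := by ring
  have e3 : 2 * ((k + n) / 2) = k + n := by ring
  rw [aC1, e1, e2, e3, sqrt_qn_mul_qn h0 h1, abs_mul, abs_mul, abs_mul, hε, one_mul,
    div_eq_mul_inv, mul_inv, abs_of_nonneg (by positivity), abs_of_nonneg (by positivity),
    abs_of_nonneg (by positivity)]
  calc (1 + q ^ 2) * (q ^ ((k - n) / 2 - 1 / 2) * ((qn q (k + n))⁻¹ * (qn q (k + n + 2))⁻¹)) *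
        (q ^ (-((k + 1 + n) / 2)) / (q⁻¹ - q) * √((1 - q ^ (2 * (k + 1))) * (1 - q ^ (2 * n))))
      ≤ (1 + q ^ 2) * (q ^ ((k - n) / 2 - 1 / 2) * (((q⁻¹ - q) / (1 - q ^ 2) * q ^ (k + n)) *
        ((q⁻¹ - q) / (1 - q ^ 2) * q ^ (k + n + 2)))) *
        (q ^ (-((k + 1 + n) / 2)) / (q⁻¹ - q) * 1) := by gcongr
    _ = (1 + q ^ 2) * (q⁻¹ - q) / (1 - q ^ 2) ^ 2 * (q ^ ((k - n) / 2 - 1 / 2) * q ^ (k + n) *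
        q ^ (k + n + 2) * q ^ (-((k + 1 + n) / 2))) := by field_simp
    _ ≤ _ := by
      rw [← Real.rpow_add h0, ← Real.rpow_add h0, ← Real.rpow_add h0]
      have : 0 ≤ (1 + q ^ 2) * (q⁻¹ - q) / (1 - q ^ 2) ^ 2 := by positivity
      gcongr _ * ?_
      exact rpow_le_rpow_of_ge h0 h1 (by linarith)

lemma abs_bC1_le (h0 : 0 < q) (h1 : q < 1) {k n ε : ℝ} (hε : |ε| = 1) (hk : 0 ≤ k) (hn : 0 ≤ n)
    (hN : 1 ≤ k + n) : |bC1 q ε ((k + n) / 2) ((k - n) / 2)| ≤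
      (1 + q ^ 2) / (1 - q ^ 2) ^ 2 * q ^ (k + n) := by
  have hδ := inv_sub_self_pos h0 h1
  have hb := one_sub_sq_pos h0 h1
  obtain ⟨i1, i2⟩ := inv_qn_nonneg_and_le h0 h1 hN
  obtain ⟨j1, j2⟩ := inv_qn_nonneg_and_le h0 h1 (by linarith : 1 ≤ k + n + 2)
  have e1 : (k + n) / 2 + (k - n) / 2 = k := by ring
  have e2 : (k + n) / 2 - (k - n) / 2 = n := by ring
  have e3 : 2 * ((k + n) / 2) = k + n := by ring
  have key : ∀ x y : ℝ, 0 ≤ x → 0 ≤ y → x + y = k + n + 1 →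
      0 ≤ qn q x * qn q y ∧ qn q x * qn q y ≤ q ^ (-(k + n + 1)) / (q⁻¹ - q) ^ 2 := by
    intro x y hx hy h
    have hx' := qn_nonneg h0 h1 hx
    have hy' := qn_nonneg h0 h1 hy
    refine ⟨by positivity, ?_⟩
    calc qn q x * qn q y ≤ (q ^ (-x) / (q⁻¹ - q)) * (q ^ (-y) / (q⁻¹ - q)) := by
          gcongr
          · exact qn_le h0 h1 x
          · exact qn_le h0 h1 y
      _ = _ := by
        rw [div_mul_div_comm, ← Real.rpow_add h0, ← h, ← sq]
        congr 2
        ring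
  obtain ⟨a1, a2⟩ := key (n + 1) k (by linarith) hk (by ring)
  obtain ⟨b1, b2⟩ := key n (k + 1) hn (by linarith) (by ring)
  have hnum : |qn q (n + 1) * qn q k - q ^ 2 * (qn q n * qn q (k + 1))| ≤
      (1 + q ^ 2) * (q ^ (-(k + n + 1)) / (q⁻¹ - q) ^ 2) := by
    have hq2 := sq_nonneg q
    rw [abs_le]
    constructor <;> nlinarith [mul_le_mul_of_nonneg_left b2 hq2, mul_nonneg hq2 b1]
  rw [bC1, e2, e1, e3, abs_mul, hε, one_mul, div_eq_mul_inv, mul_inv, abs_mul,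
    abs_of_nonneg (mul_nonneg i1 j1)]
  calc |qn q (n + 1) * qn q k - q ^ 2 * (qn q n * qn q (k + 1))| *
        ((qn q (k + n))⁻¹ * (qn q (k + n + 2))⁻¹)
      ≤ ((1 + q ^ 2) * (q ^ (-(k + n + 1)) / (q⁻¹ - q) ^ 2)) *
        (((q⁻¹ - q) / (1 - q ^ 2) * q ^ (k + n)) *
        ((q⁻¹ - q) / (1 - q ^ 2) * q ^ (k + n + 2))) := by gcongr
    _ = (1 + q ^ 2) / (1 - q ^ 2) ^ 2 *
        (q ^ (-(k + n + 1)) * q ^ (k + n) * q ^ (k + n + 2)) := by field_simp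
    _ ≤ _ := by
      rw [← Real.rpow_add h0, ← Real.rpow_add h0]
      have : 0 ≤ (1 + q ^ 2) / (1 - q ^ 2) ^ 2 := by positivity
      gcongr _ * ?_
      exact rpow_le_rpow_of_ge h0 h1 (by linarith)

lemma abs_aC2_sub_le (h0 : 0 < q) (h1 : q < 1) {k n : ℝ} (hk : 0 ≤ k) (hn : 0 ≤ n) :
    |aC2 q ((k + n) / 2) ((k - n) / 2) - √((1 - q ^ (2 * (k + 1))) * (1 - q ^ (2 * (k + 2))))| ≤
      (1 - q ^ 2)⁻¹ * q ^ (k + n) := by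
  have hb := one_sub_sq_pos h0 h1
  have e1 : (k + n) / 2 + (k - n) / 2 = k := by ring
  have e2 : 2 * ((k + n) / 2) = k + n := by ring
  have e3 : (k - n) / 2 - (k + n) / 2 - 1 / 2 + (k + n + 2) - (k + 1 + (k + 2)) / 2 = 0 := by ring
  rw [aC2, e1, e2, rpow_div_qn_mul_sqrt h0 h1, e3, Real.rpow_zero, one_mul]
  refine (abs_div_one_sub_sub_le (Real.sqrt_nonneg _) (sqrt_mul_le_one (by positivity)
    (by positivity) (Real.rpow_le_one h0.le h1.le (by positivity))) (by positivity) hb ?_).trans ?_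
  · rw [sub_sub_cancel]
    exact rpow_le_sq h0 h1 (by linarith)
  · rw [div_eq_mul_inv, mul_comm]
    exact mul_le_mul_of_nonneg_left (rpow_le_rpow_of_ge h0 h1 (by linarith)) (by positivity)

lemma abs_sqrt_mul_sub_one_le {u v : ℝ} (hu : 0 ≤ u) (hu' : u ≤ 1) (hv : 0 ≤ v) (hv' : v ≤ 1) :
    |√((1 - u) * (1 - v)) - 1| ≤ u + v := by
  have e : √((1 - u) * (1 - v)) - 1 = (√((1 - u) * (1 - v)) - √(1 - v)) + (√(1 - v) - 1) := by ring
  rw [e]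
  exact (abs_add_le _ _).trans
    (add_le_add (abs_sqrt_mul_sub_sqrt_le hu hu' hv) (abs_sqrt_sub_one_le hv hv'))

lemma abs_aC3_sub_le (h0 : 0 < q) (h1 : q < 1) {k n : ℝ} (hk : 0 ≤ k) (hn : 1 ≤ n) :
    |aC3 q ((k + n) / 2) ((k - n) / 2) - q ^ (2 * k + 1)| ≤
      ((1 - q ^ 2)⁻¹ + 2) * q ^ (k + n) := by
  have hb := one_sub_sq_pos h0 h1
  have e1 : (k + n) / 2 - (k - n) / 2 = n := by ring
  have e2 : 2 * ((k + n) / 2) = k + n := by ring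
  have e3 : (k - n) / 2 + (k + n) / 2 + 1 / 2 + (k + n) - (n + (n - 1)) / 2 = 2 * k + 1 := by ring
  rw [aC3, e1, e2, rpow_div_qn_mul_sqrt h0 h1, e3]
  have hu' := Real.rpow_le_one h0.le h1.le (by linarith : 0 ≤ 2 * n)
  have hv' := Real.rpow_le_one h0.le h1.le (by linarith : 0 ≤ 2 * (n - 1))
  have hw' : q ^ (2 * (k + n)) ≤ 1 - (1 - q ^ 2) := by
    rw [sub_sub_cancel]
    exact rpow_le_sq h0 h1 (by linarith)
  have b1 := abs_div_one_sub_sub_le (Real.sqrt_nonneg _) (sqrt_mul_le_one (u := q ^ (2 * n))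
    (v := q ^ (2 * (n - 1))) (by positivity) (by positivity) hv') (by positivity) hb hw'
  have b2 := abs_sqrt_mul_sub_one_le (by positivity) hu' (by positivity) hv'
  have b3 := (abs_add_le _ _).trans (add_le_add b1 b2)
  rw [sub_add_sub_cancel] at b3
  generalize √((1 - q ^ (2 * n)) * (1 - q ^ (2 * (n - 1)))) / (1 - q ^ (2 * (k + n))) = R at b3 ⊢
  have e : q ^ (2 * k + 1) * R - q ^ (2 * k + 1) = q ^ (2 * k + 1) * (R - 1) := by ring
  rw [e, abs_mul, abs_of_nonneg (by positivity)]
  calc q ^ (2 * k + 1) * |R - 1|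
      ≤ q ^ (2 * k + 1) * (q ^ (2 * (k + n)) / (1 - q ^ 2) +
        (q ^ (2 * n) + q ^ (2 * (n - 1)))) := by gcongr
    _ = (1 - q ^ 2)⁻¹ * (q ^ (2 * k + 1) * q ^ (2 * (k + n))) +
        (q ^ (2 * k + 1) * q ^ (2 * n) + q ^ (2 * k + 1) * q ^ (2 * (n - 1))) := by ring
    _ ≤ (1 - q ^ 2)⁻¹ * q ^ (k + n) + (q ^ (k + n) + q ^ (k + n)) := by
      rw [← Real.rpow_add h0, ← Real.rpow_add h0, ← Real.rpow_add h0]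
      gcongr (1 - q ^ 2)⁻¹ * ?_ + (?_ + ?_) <;> exact rpow_le_rpow_of_ge h0 h1 (by linarith)
    _ = _ := by ring

/-- The estimate common to the coefficients of `|l ± 1, m⟩` in `π(b)|l, m⟩`. -/
lemma abs_rpow_mul_sqrt_div_sub_le (h0 : 0 < q) (h1 : q < 1) {a u v w k n : ℝ}
    (hn : 0 ≤ n) (ha : k ≤ a) (hu : n ≤ u) (hv : 0 ≤ v) (hw : n ≤ w) (hw' : 2 ≤ w) :
    |q ^ a * (√((1 - q ^ u) * (1 - q ^ v)) / (1 - q ^ w)) - q ^ a * √(1 - q ^ v)| ≤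
      ((1 - q ^ 2)⁻¹ + 1) * q ^ (k + n) := by
  have hb := one_sub_sq_pos h0 h1
  have hu1 := Real.rpow_le_one h0.le h1.le (hn.trans hu)
  have hv1 := Real.rpow_le_one h0.le h1.le hv
  have hw1 : q ^ w ≤ 1 - (1 - q ^ 2) := by
    rw [sub_sub_cancel]
    exact rpow_le_sq h0 h1 hw'
  have b1 := abs_div_one_sub_sub_le (Real.sqrt_nonneg _) (sqrt_mul_le_one (u := q ^ u)
    (v := q ^ v) (by positivity) (by positivity) hv1) (by positivity) hb hw1
  have b2 := abs_sqrt_mul_sub_sqrt_le (v := q ^ v) (by positivity) hu1 (by positivity)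
  have b3 := (abs_add_le _ _).trans (add_le_add b1 b2)
  rw [sub_add_sub_cancel] at b3
  rw [← mul_sub, abs_mul, abs_of_nonneg (by positivity)]
  calc q ^ a * |√((1 - q ^ u) * (1 - q ^ v)) / (1 - q ^ w) - √(1 - q ^ v)|
      ≤ q ^ a * (q ^ w / (1 - q ^ 2) + q ^ u) := by gcongr
    _ = (1 - q ^ 2)⁻¹ * (q ^ a * q ^ w) + q ^ a * q ^ u := by ring
    _ ≤ (1 - q ^ 2)⁻¹ * q ^ (k + n) + q ^ (k + n) := by
      rw [← Real.rpow_add h0, ← Real.rpow_add h0]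
      gcongr (1 - q ^ 2)⁻¹ * ?_ + ?_ <;> exact rpow_le_rpow_of_ge h0 h1 (by linarith)
    _ = _ := by ring

lemma abs_bC2_sub_le (h0 : 0 < q) (h1 : q < 1) {k n : ℝ} (hk : 0 ≤ k) (hn : 0 ≤ n) :
    |bC2 q ((k + n) / 2) ((k - n) / 2) - q ^ (k + 2) * √(1 - q ^ (2 * (k + 1)))| ≤
      ((1 - q ^ 2)⁻¹ + 1) * q ^ (k + n) := by
  have e1 : (k + n) / 2 - (k - n) / 2 = n := by ring
  have e2 : 2 * ((k + n) / 2) = k + n := by ring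
  have e3 : (k + n) / 2 + (k - n) / 2 = k := by ring
  have e4 : (k - n) / 2 + 1 + (k + n + 2) - (n + 1 + (k + 1)) / 2 = k + 2 := by ring
  rw [bC2, e1, e2, e3, rpow_div_qn_mul_sqrt h0 h1, e4]
  exact abs_rpow_mul_sqrt_div_sub_le h0 h1 hn (by linarith) (by linarith) (by linarith)
    (by linarith) (by linarith)

lemma abs_bC3_sub_le (h0 : 0 < q) (h1 : q < 1) {k n : ℝ} (hk : 0 ≤ k) (hn : 0 ≤ n)
    (hN : 1 ≤ k + n) :
    |bC3 q ((k + n) / 2) ((k - n) / 2) - q ^ (k + 1) * √(1 - q ^ (2 * k))| ≤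
      ((1 - q ^ 2)⁻¹ + 1) * q ^ (k + n) := by
  have e1 : (k + n) / 2 - (k - n) / 2 = n := by ring
  have e2 : 2 * ((k + n) / 2) = k + n := by ring
  have e3 : (k + n) / 2 + (k - n) / 2 = k := by ring
  have e4 : (k - n) / 2 + 1 + (k + n) - (n + k) / 2 = k + 1 := by ring
  rw [bC3, e1, e2, e3, rpow_div_qn_mul_sqrt h0 h1, e4]
  exact abs_rpow_mul_sqrt_div_sub_le h0 h1 hn (by linarith) (by linarith) (by linarith)
    (by linarith) (by linarith)

end Estimates

/-! ### The generators as sums of elementary operators -/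

lemma exists_isElementary {q : ℝ} (h0 : 0 < q) (h1 : q < 1) {dk dn : ℤ} (hd : Even (dk + dn))
    (g : Bool → ℝ → ℝ → ℝ) {C γ : ℝ} (f : ℝ → ℝ) (hC : 0 ≤ C)
    (hg : ∀ (s : Bool) (k n : ℝ), 0 ≤ k → 0 ≤ n → 1 ≤ k + n → 0 ≤ n + dn →
      |g s ((k + n) / 2) ((k - n) / 2) - f k| ≤ C * q ^ (k + n))
    (hf : ∀ k : ℝ, 0 ≤ k → |f k - γ| ≤ C * q ^ k) (hγ : dn ≠ 0 → γ = 0) :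
    ∃ X, IsElementary q X ∧ ∀ (k n : ℤ) (s : Bool), ValidKN k n →
      X (el k n s) = ((g s (((k + n : ℤ) : ℝ) / 2) (((k - n : ℤ) : ℝ) / 2) : ℝ) : ℂ) •
        el (k + dk) (n + dn) s := by
  classical
  let c : ℤ → ℤ → Bool → ℂ := fun k n s => if ValidKN k n ∧ ValidKN (k + dk) (n + dn) then
    ((g s (((k + n : ℤ) : ℝ) / 2) (((k - n : ℤ) : ℝ) / 2) : ℝ) : ℂ) else 0
  have hs : Supported dk dn c := fun k n s hne => by
    by_contra h
    exact hne (if_neg h)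
  have hc : AlmostFun q dk dn c := by
    refine ⟨C, γ, fun k => (f k : ℂ), hC, fun k n s hv hv' => ?_, fun k hk _ => ?_,
      fun hdn => by rw [hγ hdn, Complex.ofReal_zero]⟩
    · have hk : (0 : ℝ) ≤ k := by exact_mod_cast hv.1
      have hn : (0 : ℝ) ≤ n := by exact_mod_cast hv.2.1
      have hN : (1 : ℝ) ≤ k + n := by
        obtain ⟨j, hj⟩ := hv.2.2
        have := hv.1
        have := hv.2.1
        exact_mod_cast (by lia : 1 ≤ k + n)
      have hn' : (0 : ℝ) ≤ n + dn := by exact_mod_cast hv'.2.1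
      have := hg s k n hk hn hN hn'
      simp only [c, if_pos (And.intro hv hv')]
      rw [← Complex.ofReal_sub, Complex.norm_real, Real.norm_eq_abs, ← Real.rpow_intCast]
      push_cast
      exact this
    · dsimp only
      rw [← Complex.ofReal_sub, Complex.norm_real, Real.norm_eq_abs, ← Real.rpow_intCast]
      exact hf k (by exact_mod_cast hk)
  obtain ⟨B, -, hB, -⟩ := hc.bounds h0 h1 hd hs
  obtain ⟨X, hX⟩ := exists_isShift dk dn false c hs hB
  refine ⟨X, ⟨dk, dn, c, hd, hX, hc⟩, fun k n s hv => ?_⟩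
  rw [hX.app, Bool.xor_false]
  by_cases hv' : ValidKN (k + dk) (n + dn)
  · simp only [c, if_pos (And.intro hv hv')]
  · rw [el_of_not_valid hv', smul_zero, smul_zero]

lemma abs_sgn (s : Bool) : |sgn s| = 1 := by
  cases s <;> simp [sgn]

lemma ket2_eq_el {s : Bool} {L M k n : ℤ} (hL : k + n = L) (hM : k - n = M) :
    ket2 s L M = el k n s := by
  rw [el, hL, hM]

lemma eq_of_forall_valid {X Y : HH →L[ℂ] HH}
    (h : ∀ k n s, ValidKN k n → X (el k n s) = Y (el k n s)) : X = Y := by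
  refine clm_ext_el fun k n s => ?_
  by_cases hv : ValidKN k n
  · exact h k n s hv
  · rw [el_of_not_valid hv, map_zero, map_zero]

lemma exists_isElementary_a {q : ℝ} (h0 : 0 < q) (h1 : q < 1) {πa : HH →L[ℂ] HH}
    (hπa : ∀ (p : Idx) (s : Bool), πa (bas p s) = aVal2 q s p.1.1 p.1.2) :
    ∃ X₁ X₂ X₃, IsElementary q X₁ ∧ IsElementary q X₂ ∧ IsElementary q X₃ ∧
      πa = X₁ + X₂ + X₃ := by
  have hb := one_sub_sq_pos h0 h1
  have hδ := inv_sub_self_pos h0 h1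
  have hle : ∀ {k y : ℝ}, k ≤ y → q ^ y ≤ q ^ k := fun h => rpow_le_rpow_of_ge h0 h1 h
  obtain ⟨X₁, hX₁, e₁⟩ := exists_isElementary h0 h1 (dk := 1) (dn := -1) (by decide)
    (fun s => aC1 q (sgn s)) (C := (1 + q ^ 2) * (q⁻¹ - q) / (1 - q ^ 2) ^ 2) (γ := 0)
    (fun _ => 0) (by positivity)
    (fun s k n hk hn hN _ => by simpa using abs_aC1_le h0 h1 (abs_sgn s) hk hn hN)
    (fun k _ => by rw [sub_zero, abs_zero]; positivity) (fun _ => rfl)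
  obtain ⟨X₂, hX₂, e₂⟩ := exists_isElementary h0 h1 (dk := 2) (dn := 0) (by decide)
    (fun _ => aC2 q) (C := (1 - q ^ 2)⁻¹ + 2) (γ := 1)
    (fun k => √((1 - q ^ (2 * (k + 1))) * (1 - q ^ (2 * (k + 2))))) (by positivity)
    (fun _ k n hk hn _ _ => (abs_aC2_sub_le h0 h1 hk hn).trans (by gcongr; linarith))
    (fun k hk => by
      refine (abs_sqrt_mul_sub_one_le (by positivity)
        (Real.rpow_le_one h0.le h1.le (by positivity)) (by positivity)
        (Real.rpow_le_one h0.le h1.le (by positivity))).trans ?_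
      have i1 : q ^ (2 * (k + 1)) ≤ q ^ k := hle (by linarith)
      have i2 : q ^ (2 * (k + 2)) ≤ q ^ k := hle (by linarith)
      have i3 : 0 ≤ (1 - q ^ 2)⁻¹ * q ^ k := by positivity
      linarith) (fun h => absurd rfl h)
  obtain ⟨X₃, hX₃, e₃⟩ := exists_isElementary h0 h1 (dk := 0) (dn := -2) (by decide)
    (fun _ l m => -aC3 q l m) (C := (1 - q ^ 2)⁻¹ + 2) (γ := 0)
    (fun k => -q ^ (2 * k + 1)) (by positivity)
    (fun _ k n hk hn _ hn' => by
      push_cast at hn'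
      rw [neg_sub_neg, abs_sub_comm]
      exact abs_aC3_sub_le h0 h1 hk (by linarith))
    (fun k hk => by
      rw [sub_zero, abs_neg, abs_of_nonneg (by positivity)]
      have i1 : q ^ (2 * k + 1) ≤ q ^ k := hle (by linarith)
      have i2 : 0 ≤ (1 - q ^ 2)⁻¹ * q ^ k := by positivity
      have i3 : 0 < q ^ k := by positivity
      linarith) (fun _ => rfl)
  refine ⟨X₁, X₂, X₃, hX₁, hX₂, hX₃, eq_of_forall_valid fun k n s hv => ?_⟩
  obtain ⟨p, hp, hb⟩ := exists_bas_eq_el hv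
  rw [add_apply, add_apply, e₁ k n s hv, e₂ k n s hv, e₃ k n s hv, hb, hπa, hp, aVal2,
    ket2_eq_el (k := k + 1) (n := n + -1) (by ring) (by ring),
    ket2_eq_el (k := k + 2) (n := n + 0) (by ring) (by ring),
    ket2_eq_el (k := k + 0) (n := n + -2) (by ring) (by ring), sub_eq_add_neg, ← neg_smul,
    Complex.ofReal_neg]

lemma exists_isElementary_b {q : ℝ} (h0 : 0 < q) (h1 : q < 1) {πb : HH →L[ℂ] HH}
    (hπb : ∀ (p : Idx) (s : Bool), πb (bas p s) = bVal2 q s p.1.1 p.1.2) :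
    ∃ X₁ X₂ X₃, IsElementary q X₁ ∧ IsElementary q X₂ ∧ IsElementary q X₃ ∧
      πb = X₁ + X₂ + X₃ := by
  have hb := one_sub_sq_pos h0 h1
  have hsmall : ∀ {k a v : ℝ}, 0 ≤ k → k ≤ a →
      |(-(q ^ a * √(1 - q ^ v))) - 0| ≤ ((1 - q ^ 2)⁻¹ + 1) * q ^ k := by
    intro k a v hk ha
    have i1 : √(1 - q ^ v) ≤ 1 :=
      Real.sqrt_le_one.2 (by linarith [Real.rpow_pos_of_pos h0 v])
    have i2 : q ^ a ≤ q ^ k := rpow_le_rpow_of_ge h0 h1 ha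
    have i3 : 0 ≤ (1 - q ^ 2)⁻¹ * q ^ k := by positivity
    rw [sub_zero, abs_neg, abs_of_nonneg (by positivity)]
    have i4 := mul_le_of_le_one_right (by positivity : 0 ≤ q ^ a) i1
    linarith
  obtain ⟨X₁, hX₁, e₁⟩ := exists_isElementary h0 h1 (dk := 0) (dn := 0) (by decide)
    (fun s => bC1 q (sgn s)) (C := (1 + q ^ 2) / (1 - q ^ 2) ^ 2) (γ := 0)
    (fun _ => 0) (by positivity)
    (fun s k n hk hn hN _ => by simpa using abs_bC1_le h0 h1 (abs_sgn s) hk hn hN)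
    (fun k _ => by rw [sub_zero, abs_zero]; positivity) (fun _ => rfl)
  obtain ⟨X₂, hX₂, e₂⟩ := exists_isElementary h0 h1 (dk := 1) (dn := 1) (by decide)
    (fun _ l m => -bC2 q l m) (C := (1 - q ^ 2)⁻¹ + 1) (γ := 0)
    (fun k => -(q ^ (k + 2) * √(1 - q ^ (2 * (k + 1))))) (by positivity)
    (fun _ k n hk hn _ _ => by
      rw [neg_sub_neg, abs_sub_comm]
      exact abs_bC2_sub_le h0 h1 hk hn)
    (fun k hk => hsmall hk (by linarith)) (fun _ => rfl)
  obtain ⟨X₃, hX₃, e₃⟩ := exists_isElementary h0 h1 (dk := -1) (dn := -1) (by decide)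
    (fun _ l m => -bC3 q l m) (C := (1 - q ^ 2)⁻¹ + 1) (γ := 0)
    (fun k => -(q ^ (k + 1) * √(1 - q ^ (2 * k)))) (by positivity)
    (fun _ k n hk hn hN _ => by
      rw [neg_sub_neg, abs_sub_comm]
      exact abs_bC3_sub_le h0 h1 hk hn hN)
    (fun k hk => hsmall hk (by linarith)) (fun _ => rfl)
  refine ⟨X₁, X₂, X₃, hX₁, hX₂, hX₃, eq_of_forall_valid fun k n s hv => ?_⟩
  obtain ⟨p, hp, hb⟩ := exists_bas_eq_el hv
  rw [add_apply, add_apply, e₁ k n s hv, e₂ k n s hv, e₃ k n s hv, hb, hπb, hp, bVal2,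
    ket2_eq_el (k := k + 0) (n := n + 0) (by ring) (by ring),
    ket2_eq_el (k := k + 1) (n := n + 1) (by ring) (by ring),
    ket2_eq_el (k := k + -1) (n := n + -1) (by ring) (by ring), sub_eq_add_neg, sub_eq_add_neg,
    ← neg_smul, ← neg_smul, Complex.ofReal_neg, Complex.ofReal_neg]

/-- The elements of the algebra generated by `π(a)` and `π(b)` are obtained from elementary
operators and scalars by sums and products. -/
lemma adjoin_generators_induction {q : ℝ} (h0 : 0 < q) (h1 : q < 1) {πa πb : HH →L[ℂ] HH}
    (hπa : ∀ (p : Idx) (s : Bool), πa (bas p s) = aVal2 q s p.1.1 p.1.2)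
    (hπb : ∀ (p : Idx) (s : Bool), πb (bas p s) = bVal2 q s p.1.1 p.1.2)
    {P : (HH →L[ℂ] HH) → Prop} (helem : ∀ X, IsElementary q X → P X)
    (hadd : ∀ X Y, P X → P Y → P (X + Y)) (hmul : ∀ X Y, P X → P Y → P (X * Y))
    (hscalar : ∀ z : ℂ, P (algebraMap ℂ (HH →L[ℂ] HH) z)) :
    ∀ x ∈ StarAlgebra.adjoin ℂ ({πa, πb} : Set (HH →L[ℂ] HH)), P x := by
  have hsum : ∀ π : HH →L[ℂ] HH, (∃ X₁ X₂ X₃, IsElementary q X₁ ∧ IsElementary q X₂ ∧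
      IsElementary q X₃ ∧ π = X₁ + X₂ + X₃) → P π ∧ P (star π) := by
    rintro _ ⟨X₁, X₂, X₃, hX₁, hX₂, hX₃, rfl⟩
    rw [star_add, star_add]
    exact ⟨hadd _ _ (hadd _ _ (helem _ hX₁) (helem _ hX₂)) (helem _ hX₃),
      hadd _ _ (hadd _ _ (helem _ (hX₁.star h0)) (helem _ (hX₂.star h0))) (helem _ (hX₃.star h0))⟩
  have ha := hsum πa (exists_isElementary_a h0 h1 hπa)
  have hb := hsum πb (exists_isElementary_b h0 h1 hπb)
  intro x hx
  refine Algebra.adjoin_induction (p := fun x _ => P x) (fun x hx => ?_) hscalar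
    (fun X Y _ _ => hadd X Y) (fun X Y _ _ => hmul X Y) hx
  rcases hx with (rfl | rfl) | h
  · exact ha.1
  · exact hb.1
  · rcases h with h | h
    · rw [← star_star x, h]
      exact ha.2
    · rw [← star_star x, (h : star x = πb)]
      exact hb.2

/-- The Dirac operator `D` satisfies the first-order condition modulo compact
operators: for all `x, y ∈ A`, the operator `[JyJ⁻¹, [D, x]]` is compact, where `[D, x]` is the
bounded extension of `Dx - xD` (which exists). -/
theorem statement10 (q : ℝ) (hq0 : 0 < q) (hq1 : q < 1)
    (πa πb : HH →L[ℂ] HH)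
    (hπa : ∀ (p : Idx) (s : Bool), πa (bas p s) = aVal2 q s p.1.1 p.1.2)
    (hπb : ∀ (p : Idx) (s : Bool), πb (bas p s) = bVal2 q s p.1.1 p.1.2)
    (J : HH →SL[starRingEnd ℂ] HH)
    (hJ : ∀ (p : Idx) (s : Bool), J (bas p s) = (Complex.I ^ p.1.2) • bas (pFlip p) (!s))
    (D : HH →ₗ.[ℂ] HH)
    (hdom : D.domain = Submodule.span ℂ (Set.range fun y : Idx × Bool => bas y.1 y.2))
    (hD : ∀ (p : Idx) (s : Bool) (h : bas p s ∈ D.domain),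
      D ⟨bas p s, h⟩ = (((p.1.1 : ℝ) / 2 + 1 / 2 : ℝ) : ℂ) • bas p (!s))
    :
    ∀ x ∈ StarAlgebra.adjoin ℂ ({πa, πb} : Set (HH →L[ℂ] HH)),
      (∀ v ∈ D.domain, x v ∈ D.domain) ∧
      (∃ T : HH →L[ℂ] HH, ∀ (v : HH) (hv : v ∈ D.domain) (hxv : x v ∈ D.domain),
        T v = D ⟨x v, hxv⟩ - x (D ⟨v, hv⟩)) ∧
      (∀ T : HH →L[ℂ] HH,
        (∀ (v : HH) (hv : v ∈ D.domain) (hxv : x v ∈ D.domain),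
          T v = D ⟨x v, hxv⟩ - x (D ⟨v, hv⟩)) →
        ∀ y ∈ StarAlgebra.adjoin ℂ ({πa, πb} : Set (HH →L[ℂ] HH)),
          IsCompactOperator (fun v : HH => J (y (-(J (T v)))) - T (J (y (-(J v)))))) := by
  have hr0 : 0 < √q := Real.sqrt_pos.2 hq0
  have hr1 : √q < 1 := (Real.sqrt_lt_sqrt hq0.le hq1).trans_eq Real.sqrt_one
  have hrq : q ≤ √q := Real.le_sqrt_of_sq_le (by nlinarith)
  intro x hx
  obtain ⟨hX, T₀, hT₀, hY⟩ : DiffCommutes (√q) D x :=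
    adjoin_generators_induction (P := DiffCommutes (√q) D) hq0 hq1 hπa hπb
      (fun X hX => IsElementary.diffCommutes hr0 hr1 hdom hD (by rwa [Real.sq_sqrt hq0.le]))
      (fun _ _ => DiffCommutes.add) (fun _ _ => DiffCommutes.mul) (DiffCommutes.algebraMap _) x hx
  refine ⟨hX, ⟨T₀, fun v hv _ => hT₀ v hv⟩, fun T hT y hy => ?_⟩
  have hTT : T = T₀ := clm_ext_bas fun p s => by
    have hm : bas p s ∈ D.domain := hdom ▸ Submodule.subset_span ⟨(p, s), rfl⟩
    rw [hT _ hm (hX _ hm), hT₀ _ hm]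
  subst hTT
  have key : IsCompactOperator (conjJ J y * T - T * conjJ J y) := by
    refine adjoin_generators_induction hq0 hq1 hπa hπb
      (P := fun y => IsCompactOperator (conjJ J y * T - T * conjJ J y))
      (fun Y hY' => ?_) (fun Y Y' h h' => ?_) (fun Y Y' h h' => ?_) (fun z => ?_) y hy
    · obtain ⟨dk, dn, c, hd, hs, hc⟩ := hY'
      exact (hY _ (IsElementary.conjJ hJ ⟨dk, dn, c, hd, hs, hc.of_le hq0 hrq⟩)).1
    · have e : conjJ J (Y + Y') * T - T * conjJ J (Y + Y') =
          (conjJ J Y * T - T * conjJ J Y) + (conjJ J Y' * T - T * conjJ J Y') := by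
        rw [conjJ_add]
        noncomm_ring
      rw [e]
      exact h.add h'
    · have e : ∀ Z : HH →L[ℂ] HH, T * Z - Z * T = -(Z * T - T * Z) := fun Z => (neg_sub _ _).symm
      rw [conjJ_mul hJ, ← neg_sub]
      refine (isCompactOperator_commutator_mul ?_ ?_).neg <;> rw [e]
      · exact h.neg
      · exact h'.neg
    · rw [conjJ_algebraMap hJ, Algebra.commutes, sub_self]
      exact isCompactOperator_zero
  exact key
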